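/- arXiv:2307.01839 — 2 statements merged into one kernel-verified Lean document; each statement's English description precedes it below -/
import Mathlib

section
/- For d ≥ 2, κ_i ≥ 0 (i = 1,…,d+1), n ∈ ℕ_0 and every polynomial f in d variables of degree at most n: (a) for each 1 ≤ i ≤ d, max over 1 ≤ ℓ ≤ d with ℓ ≠ i of ‖ (√(x_i(1−|x|))/√(1−x_ℓ)) ∂_i f ‖_{κ,2} ≤ √(n(n+|κ|+d)) ‖f‖_{κ,2}; and (b) for each 1 ≤ i < j ≤ d, max over 1 ≤ ℓ ≤ d+1 with ℓ ≠ i and ℓ ≠ j of ‖ (√(x_i x_j)/√(1−x_ℓ)) ∂_{i,j} f ‖_{κ,2} ≤ √(n(n+|κ|+d)) ‖f‖_{κ,2}, where x_{d+1} = 1 − |x|. -/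
open MeasureTheory Finset

noncomputable section

/-- The simplex `△^d = {x : x_i ≥ 0, x_1 + ⋯ + x_d ≤ 1}`. -/
def Splx (d : ℕ) : Set (Fin d → ℝ) := {x | (∀ i, 0 ≤ x i) ∧ ∑ i, x i ≤ 1}

/-- The `i`-th partial derivative. -/
def pd {d : ℕ} (i : Fin d) (f : (Fin d → ℝ) → ℝ) : (Fin d → ℝ) → ℝ :=
  fun x => fderiv ℝ f x (Pi.single i 1)

/-- `∂_{i,j} = ∂_i - ∂_j`. -/
def pdd {d : ℕ} (i j : Fin d) (f : (Fin d → ℝ) → ℝ) : (Fin d → ℝ) → ℝ :=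
  fun x => pd i f x - pd j f x

/-- `⟨x,∇⟩ = ∑ x_i ∂_i`. -/
def xgrad {d : ℕ} (f : (Fin d → ℝ) → ℝ) : (Fin d → ℝ) → ℝ :=
  fun x => ∑ i, x i * pd i f x

/-- The Jacobi weight `W_κ(x) = x_1^{κ_1} ⋯ x_d^{κ_d} (1-|x|)^{κ_{d+1}}`. -/
def Wk {d : ℕ} (κ : Fin (d+1) → ℝ) (x : Fin d → ℝ) : ℝ :=
  (∏ i : Fin d, x i ^ κ i.castSucc) * (1 - ∑ i, x i) ^ κ (Fin.last d)

/-- The spectral operator `D_κ`. -/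
def Dk {d : ℕ} (κ : Fin (d+1) → ℝ) (f : (Fin d → ℝ) → ℝ) (x : Fin d → ℝ) : ℝ :=
  (∑ i, x i * (1 - x i) * pd i (pd i f) x)
    - 2 * ∑ i, ∑ j ∈ Finset.univ.filter (fun j => i < j), x i * x j * pd i (pd j f) x
    + ∑ i, (κ i.castSucc + 1 - ((∑ k, κ k) + (d : ℝ) + 1) * x i) * pd i f x

/-- The normalizing constant `b_κ`. -/
def bk {d : ℕ} (κ : Fin (d+1) → ℝ) : ℝ :=
  Real.Gamma ((∑ i, κ i) + (d : ℝ) + 1) / ∏ i, Real.Gamma (κ i + 1)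

/-- The inner product `⟨f,g⟩_κ = b_κ ∫_{△^d} f g W_κ`. -/
def ipk {d : ℕ} (κ : Fin (d+1) → ℝ) (f g : (Fin d → ℝ) → ℝ) : ℝ :=
  bk κ * ∫ x in Splx d, f x * g x * Wk κ x

/-- The norm `‖f‖_{κ,2}`. -/
def nrm2 {d : ℕ} (κ : Fin (d+1) → ℝ) (f : (Fin d → ℝ) → ℝ) : ℝ :=
  Real.sqrt (ipk κ f f)

/-- Membership in `V_n^d(W_κ)`: a polynomial of degree (at most) `n` orthogonal to all
polynomials of lower degree. -/
def InVn (d n : ℕ) (κ : Fin (d+1) → ℝ) (f : MvPolynomial (Fin d) ℝ) : Prop :=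
  f.totalDegree ≤ n ∧ ∀ g : MvPolynomial (Fin d) ℝ, g.totalDegree < n →
    ipk κ (fun x => MvPolynomial.eval x f) (fun x => MvPolynomial.eval x g) = 0

/-- `x_k` for `1 ≤ k ≤ d+1`, with the convention `x_{d+1} = 1 - |x|`. -/
def xe {d : ℕ} (x : Fin d → ℝ) (k : Fin (d+1)) : ℝ :=
  if h : (k : ℕ) < d then x ⟨(k : ℕ), h⟩ else 1 - ∑ i, x i

open MvPolynomial in
/-- The sum of all variables. -/
def coordSum (σ : Type*) [Fintype σ] : MvPolynomial σ ℝ := ∑ a, X a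

open MvPolynomial in
/-- The multivariate Laguerre-type operator `∑ₐ (Xₐ ∂ₐ² + (κₐ + 1) ∂ₐ)`. -/
def laguerreOp {σ : Type*} [Fintype σ] (κ : σ → ℝ) (P : MvPolynomial σ ℝ) : MvPolynomial σ ℝ :=
  ∑ a, (pderiv a (X a * pderiv a P) + C (κ a) * pderiv a P)

open MvPolynomial in
/-- The carré du champ `∑ₐ Xₐ ∂ₐF ∂ₐG`. -/
def carre {σ : Type*} [Fintype σ] (F G : MvPolynomial σ ℝ) : MvPolynomial σ ℝ :=
  ∑ a, X a * pderiv a F * pderiv a G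

section Algebra

open MvPolynomial

lemma pderiv_of_isHomogeneous_zero {σ : Type*} {P : MvPolynomial σ ℝ} (hP : P.IsHomogeneous 0) (a : σ) :
    pderiv a P = 0 := by
  rw [totalDegree_eq_zero_iff_eq_C.1 ((totalDegree_zero_iff_isHomogeneous σ).2 hP), pderiv_C]

lemma X_mul_pderiv_isHomogeneous {σ : Type*} {n : ℕ} {P : MvPolynomial σ ℝ}
    (hP : P.IsHomogeneous n) (a : σ) :
    (X a * pderiv a P).IsHomogeneous n := by
  cases n with
  | zero =>
    simp [pderiv_of_isHomogeneous_zero hP, isHomogeneous_zero]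
  | succ n => simpa [add_comm] using (isHomogeneous_X ℝ a).mul hP.pderiv

variable {σ : Type*} [Fintype σ]

lemma coordSum_isHomogeneous : (coordSum σ).IsHomogeneous 1 :=
  IsHomogeneous.sum _ _ _ fun a _ => isHomogeneous_X ℝ a

lemma carre_comm (F G : MvPolynomial σ ℝ) : carre F G = carre G F :=
  Finset.sum_congr rfl fun _ _ => by ring

lemma laguerreOp_add (κ : σ → ℝ) (P Q : MvPolynomial σ ℝ) :
    laguerreOp κ (P + Q) = laguerreOp κ P + laguerreOp κ Q := by
  simp only [laguerreOp, ← Finset.sum_add_distrib, map_add, mul_add]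
  exact Finset.sum_congr rfl fun _ _ => by ring

lemma laguerreOp_isHomogeneous (κ : σ → ℝ) {n : ℕ} {P : MvPolynomial σ ℝ}
    (hP : P.IsHomogeneous n) : (laguerreOp κ P).IsHomogeneous (n - 1) :=
  IsHomogeneous.sum _ _ _ fun a _ =>
    (X_mul_pderiv_isHomogeneous hP a).pderiv.add (hP.pderiv.C_mul _)

lemma laguerreOp_of_zero (κ : σ → ℝ) {P : MvPolynomial σ ℝ}
    (hP : P.IsHomogeneous 0) : laguerreOp κ P = 0 := by
  simp [laguerreOp, pderiv_of_isHomogeneous_zero hP]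

lemma coordSum_mul_laguerreOp_isHomogeneous (κ : σ → ℝ) {n : ℕ} {P : MvPolynomial σ ℝ}
    (hP : P.IsHomogeneous n) : (coordSum σ * laguerreOp κ P).IsHomogeneous n := by
  cases n with
  | zero => simp [laguerreOp_of_zero κ hP, isHomogeneous_zero]
  | succ n => simpa [add_comm] using coordSum_isHomogeneous.mul (laguerreOp_isHomogeneous κ hP)

lemma pderiv_coordSum (a : σ) : pderiv a (coordSum σ) = 1 := by
  classical
  simp [coordSum, pderiv_X, Pi.single_apply]

lemma laguerreOp_coordSum_mul (κ : σ → ℝ) {n : ℕ} {Q : MvPolynomial σ ℝ}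
    (hQ : Q.IsHomogeneous n) :
    laguerreOp κ (coordSum σ * Q) =
      coordSum σ * laguerreOp κ Q + C (2 * n + Fintype.card σ + ∑ a, κ a) * Q := by
  have key : ∀ a, pderiv a (X a * pderiv a (coordSum σ * Q)) +
        C (κ a) * pderiv a (coordSum σ * Q) =
      coordSum σ * (pderiv a (X a * pderiv a Q) + C (κ a) * pderiv a Q) +
        (2 * (X a * pderiv a Q) + (1 + C (κ a)) * Q) := fun a => by
    simp only [pderiv_mul, pderiv_coordSum, map_add, pderiv_X_self, pderiv_one]
    ring
  have euler := hQ.sum_X_mul_pderiv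
  simp only [laguerreOp, key, Finset.sum_add_distrib, ← Finset.mul_sum, ← Finset.sum_mul, euler]
  simp only [nsmul_eq_mul, Finset.sum_const, Finset.card_univ, map_add, map_mul, map_sum,
    map_natCast, map_ofNat]
  ring

variable {κ : σ → ℝ} {E : MvPolynomial σ ℝ →ₗ[ℝ] ℝ}

/-- The moment recurrence of the Dirichlet distribution as integration by parts. -/
lemma dirichlet_integration_by_parts
    (hE : ∀ (a : σ) (m : σ →₀ ℕ), ((∑ b, κ b) + m.degree + Fintype.card σ) *
      E (X a * monomial m 1) = (κ a + m a + 1) * E (monomial m 1))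
    {N : ℕ} {P : MvPolynomial σ ℝ} (hP : P.IsHomogeneous N) (a : σ) :
    ((∑ b, κ b) + N + Fintype.card σ) * E (X a * P) =
      E (pderiv a (X a * P) + C (κ a) * P) := by
  have main : ∀ m : σ →₀ ℕ, m.degree = N →
      ((∑ b, κ b) + N + Fintype.card σ) * E (X a * monomial m 1) =
      E (pderiv a (X a * monomial m 1) + C (κ a) * monomial m 1) := by
    rintro m rfl
    rw [hE, pderiv_mul, pderiv_X_self, X_mul_pderiv_monomial, one_mul, ← smul_eq_C_mul]
    rw [map_add, map_add, map_nsmul, map_smul, smul_eq_mul, nsmul_eq_mul]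
    ring
  rw [P.as_sum]
  simp only [Finset.mul_sum, map_sum, ← Finset.sum_add_distrib]
  refine Finset.sum_congr rfl fun m hm => ?_
  have hmd : m.degree = N := by
    by_contra h
    exact (mem_support_iff.1 hm) (hP.coeff_eq_zero h)
  have h1 : monomial m (P.coeff m) = C (P.coeff m) * monomial m (1 : ℝ) := by
    rw [C_mul_monomial, mul_one]
  have h2 : X a * (C (P.coeff m) * monomial m (1 : ℝ)) = P.coeff m • (X a * monomial m 1) := by
    rw [smul_eq_C_mul]; ring
  have h3 : pderiv a (P.coeff m • (X a * monomial m (1 : ℝ))) +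
      C (κ a) * (C (P.coeff m) * monomial m 1) =
      P.coeff m • (pderiv a (X a * monomial m 1) + C (κ a) * monomial m 1) := by
    rw [Derivation.map_smul, smul_eq_C_mul, smul_eq_C_mul]; ring
  rw [h1, h2, h3, map_smul, map_smul, smul_eq_mul, smul_eq_mul, ← main m hmd]
  ring

lemma E_carre
    (hE : ∀ (a : σ) (m : σ →₀ ℕ), ((∑ b, κ b) + m.degree + Fintype.card σ) *
      E (X a * monomial m 1) = (κ a + m a + 1) * E (monomial m 1))
    {n m : ℕ} {F G : MvPolynomial σ ℝ} (hF : F.IsHomogeneous n) (hG : G.IsHomogeneous m) :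
    E (carre F G) = n * ((∑ b, κ b) + (n + m) + Fintype.card σ - 1) * E (F * G) -
      E (laguerreOp κ F * G) := by
  have euler := hF.sum_X_mul_pderiv
  cases n with
  | zero =>
    simp [laguerreOp_of_zero κ hF, carre, pderiv_of_isHomogeneous_zero hF]
  | succ n =>
    have ibp : ∀ a, ((∑ b, κ b) + (n + m : ℕ) + Fintype.card σ) * E (X a * (pderiv a F * G)) =
        E ((pderiv a (X a * pderiv a F) + C (κ a) * pderiv a F) * G) +
          E (X a * pderiv a F * pderiv a G) := fun a => by
      have hFa : (pderiv a F).IsHomogeneous n := hF.pderiv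
      rw [dirichlet_integration_by_parts hE (hFa.mul hG) a, ← map_add]
      congr 1
      rw [← mul_assoc (X a), pderiv_mul (f := X a * pderiv a F)]
      ring
    have hsum := Finset.sum_congr (s₁ := Finset.univ) rfl fun a _ => ibp a
    rw [← Finset.mul_sum, Finset.sum_add_distrib, ← map_sum, ← map_sum, ← map_sum,
      ← Finset.sum_mul] at hsum
    simp only [← mul_assoc] at hsum
    rw [← Finset.sum_mul, euler, smul_mul_assoc, map_nsmul, nsmul_eq_mul] at hsum
    rw [laguerreOp, carre]
    push_cast at hsum ⊢
    linear_combination -hsum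

/-- Orthogonal projection onto a finite-dimensional space for a positive semidefinite form. -/
lemma exists_proj {V : Type*} [AddCommGroup V] [Module ℝ V] (B : V →ₗ[ℝ] V →ₗ[ℝ] ℝ)
    (hsymm : ∀ x y, B x y = B y x) (hpos : ∀ x, 0 ≤ B x x)
    (W : Submodule ℝ V) [Module.Finite ℝ W] (x : V) :
    ∃ y ∈ W, ∀ z ∈ W, B (x - y) z = 0 := by
  let b : W →ₗ[ℝ] Module.Dual ℝ W := (B.domRestrict₁₂ W W)
  have hφ : (B x ∘ₗ W.subtype) ∈ (LinearMap.ker b).dualAnnihilator := by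
    rw [Submodule.mem_dualAnnihilator]
    intro w hw
    have h0 : B (w : V) w = 0 := by
      have := LinearMap.congr_fun (LinearMap.mem_ker.1 hw) w
      exact this
    have hquad : ∀ t : ℝ, 0 ≤ B x x + 2 * t * B x w := fun t => by
      have h := hpos (x + t • (w : V))
      simp only [map_add, map_smul, LinearMap.add_apply, LinearMap.smul_apply, smul_eq_mul, h0,
        hsymm w x] at h
      linarith
    by_contra hne
    change B x w ≠ 0 at hne
    have h := hquad (-(B x x + 1) / (2 * B x w))
    have e : 2 * (-(B x x + 1) / (2 * B x w)) * B x w = -(B x x + 1) := by field_simp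
    linarith
  rw [← LinearMap.range_dualMap_eq_dualAnnihilator_ker] at hφ
  obtain ⟨ψ, hψ⟩ := hφ
  obtain ⟨y, rfl⟩ := (Module.evalEquiv ℝ W).surjective ψ
  refine ⟨y, y.2, fun z hz => ?_⟩
  have h := LinearMap.congr_fun hψ ⟨z, hz⟩
  have h' : B z y = B x z := h
  rw [map_sub, LinearMap.sub_apply, ← h', hsymm z y, sub_self]

lemma E_laguerreOp_mul_self_nonneg
    (hE : ∀ (a : σ) (m : σ →₀ ℕ), ((∑ b, κ b) + m.degree + Fintype.card σ) *
      E (X a * monomial m 1) = (κ a + m a + 1) * E (monomial m 1))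
    (hκ : ∀ a, 0 ≤ κ a) (hpos : ∀ P, 0 ≤ E (P * P)) (hS : ∀ P, E (coordSum σ * P) = E P)
    (n : ℕ) {F : MvPolynomial σ ℝ} (hF : F.IsHomogeneous n) : 0 ≤ E (laguerreOp κ F * F) := by
  induction n generalizing F with
  | zero => simp [laguerreOp_of_zero κ hF]
  | succ n ih =>
    have : Module.Finite ℝ (homogeneousSubmodule σ ℝ n) :=
      Module.Finite.iff_fg.2 (homogeneousSubmodule_fg σ ℝ n)
    obtain ⟨Q, hQ, horth⟩ := exists_proj ((LinearMap.mul ℝ (MvPolynomial σ ℝ)).compr₂ E)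
      (fun x y => by simp [mul_comm]) (fun x => by simpa using hpos x)
      (homogeneousSubmodule σ ℝ n) F
    rw [mem_homogeneousSubmodule] at hQ
    set S := coordSum σ with hSdef
    have hSQ : (S * Q).IsHomogeneous (n + 1) := by
      simpa [add_comm] using coordSum_isHomogeneous.mul hQ
    obtain ⟨P, hPdef⟩ : ∃ P, P = F - S * Q := ⟨_, rfl⟩
    have hP : P.IsHomogeneous (n + 1) := hPdef ▸ hF.sub hSQ
    have hPorth : ∀ G : MvPolynomial σ ℝ, G.IsHomogeneous n → E (P * G) = 0 := fun G hG => by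
      have h := horth G hG
      rw [LinearMap.compr₂_apply, LinearMap.mul_apply', sub_mul, map_sub] at h
      rw [hPdef, sub_mul, mul_assoc, map_sub, hS, h]
    have hFP : F = P + S * Q := by rw [hPdef]; ring
    have hLP : (laguerreOp κ P).IsHomogeneous n := laguerreOp_isHomogeneous κ hP
    have hLSQ : (laguerreOp κ (S * Q)).IsHomogeneous n := laguerreOp_isHomogeneous κ hSQ
    have hPQ : E (laguerreOp κ P * Q) = 0 := by
      have h1 := E_carre hE hP hQ
      have h2 := E_carre hE hQ hP
      have h3 := hPorth _ (coordSum_mul_laguerreOp_isHomogeneous κ hQ)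
      rw [mul_left_comm, hS, mul_comm] at h3
      rw [hPorth Q hQ] at h1
      rw [mul_comm Q P, hPorth Q hQ, h3, carre_comm, h1] at h2
      linarith
    have e1 : E (laguerreOp κ P * P) = 0 := by rw [mul_comm]; exact hPorth _ hLP
    have e2 : E (laguerreOp κ P * (S * Q)) = 0 := by rw [mul_left_comm, hS, hPQ]
    have e3 : E (laguerreOp κ (S * Q) * P) = 0 := by rw [mul_comm]; exact hPorth _ hLSQ
    have e4 : 0 ≤ E (laguerreOp κ (S * Q) * (S * Q)) := by
      rw [mul_left_comm, hS, laguerreOp_coordSum_mul κ hQ, add_mul, mul_assoc, mul_assoc,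
        map_add, hS, ← smul_eq_C_mul, map_smul, smul_eq_mul]
      have := Finset.sum_nonneg fun a (_ : a ∈ Finset.univ) => hκ a
      exact add_nonneg (ih hQ) (mul_nonneg (by positivity) (hpos Q))
    rw [hFP, laguerreOp_add, add_mul, mul_add, mul_add]
    simp only [map_add]
    linarith

lemma E_carre_self_le
    (hE : ∀ (a : σ) (m : σ →₀ ℕ), ((∑ b, κ b) + m.degree + Fintype.card σ) *
      E (X a * monomial m 1) = (κ a + m a + 1) * E (monomial m 1))
    (hκ : ∀ a, 0 ≤ κ a) (hpos : ∀ P, 0 ≤ E (P * P)) (hS : ∀ P, E (coordSum σ * P) = E P)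
    {n : ℕ} {F : MvPolynomial σ ℝ} (hF : F.IsHomogeneous n) :
    E (carre F F) ≤ n * ((∑ b, κ b) + (n + n) + Fintype.card σ - 1) * E (F * F) := by
  rw [E_carre hE hF hF]
  linarith [E_laguerreOp_mul_self_nonneg hE hκ hpos hS n hF]

end Algebra

section Simplex

variable {d : ℕ}

lemma xe_castSucc (x : Fin d → ℝ) (i : Fin d) : xe x i.castSucc = x i := by simp [xe]

lemma xe_last (x : Fin d → ℝ) : xe x (Fin.last d) = 1 - ∑ i, x i := by simp [xe]

lemma sum_xe (x : Fin d → ℝ) : ∑ a, xe x a = 1 := by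
  simp [Fin.sum_univ_castSucc, xe_castSucc, xe_last]

lemma continuous_xe (a : Fin (d + 1)) : Continuous fun x : Fin d → ℝ => xe x a := by
  refine Fin.lastCases ?_ (fun i => ?_) a
  · simp only [xe_last]; fun_prop
  · simp only [xe_castSucc]; fun_prop

lemma mem_Splx_iff {x : Fin d → ℝ} : x ∈ Splx d ↔ ∀ a, 0 ≤ xe x a := by
  simp [Splx, Fin.forall_fin_succ', xe_castSucc, xe_last]

lemma isClosed_Splx : IsClosed (Splx d) := by
  have : Splx d = ⋂ a, {x | 0 ≤ xe x a} := by ext; simp [mem_Splx_iff]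
  rw [this]
  exact isClosed_iInter fun a => isClosed_le continuous_const (continuous_xe a)

lemma isCompact_Splx : IsCompact (Splx d) := by
  refine (isCompact_univ_pi fun _ => isCompact_Icc (a := (0 : ℝ)) (b := 1)).of_isClosed_subset
    isClosed_Splx fun x hx i _ => ⟨hx.1 i, ?_⟩
  exact (Finset.single_le_sum (fun j _ => hx.1 j) (Finset.mem_univ i)).trans hx.2

lemma Wk_eq_prod (κ : Fin (d + 1) → ℝ) (x : Fin d → ℝ) : Wk κ x = ∏ a, xe x a ^ κ a := by
  simp [Wk, Fin.prod_univ_castSucc, xe_castSucc, xe_last]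

lemma continuous_prod_xe_rpow {α : Fin (d + 1) → ℝ} (hα : ∀ a, 0 ≤ α a) :
    Continuous fun x : Fin d → ℝ => ∏ a, xe x a ^ α a :=
  continuous_finsetProd _ fun a _ => (continuous_xe a).rpow_const fun _ => Or.inr (hα a)

lemma xe_cons_zero (t : ℝ) (y : Fin d → ℝ) :
    xe (Fin.cons t y : Fin (d + 1) → ℝ) 0 = t := by
  simpa using xe_castSucc (Fin.cons t y : Fin (d + 1) → ℝ) 0

lemma xe_cons_smul_succ (t : ℝ) (z : Fin d → ℝ) (a : Fin (d + 1)) :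
    xe (Fin.cons t ((1 - t) • z) : Fin (d + 1) → ℝ) a.succ = (1 - t) * xe z a := by
  refine Fin.lastCases ?_ (fun i => ?_) a
  · rw [Fin.succ_last, xe_last, xe_last, Fin.sum_univ_succ]
    simp only [Fin.cons_zero, Fin.cons_succ, Pi.smul_apply, smul_eq_mul, ← Finset.mul_sum]
    ring
  · rw [Fin.succ_castSucc, xe_castSucc, xe_castSucc]
    simp

lemma integral_rpow_mul_one_sub_rpow {a b : ℝ} (ha : 0 ≤ a) (hb : 0 ≤ b) :
    ∫ t in Set.Ioo (0 : ℝ) 1, t ^ a * (1 - t) ^ b =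
      Real.Gamma (a + 1) * Real.Gamma (b + 1) / Real.Gamma (a + b + 2) := by
  have h := ProbabilityTheory.beta_eq_betaIntegralReal (a + 1) (b + 1) (by linarith) (by linarith)
  rw [ProbabilityTheory.beta, show a + 1 + (b + 1) = a + b + 2 by ring] at h
  rw [h, ← integral_Ioc_eq_integral_Ioo, ← intervalIntegral.integral_of_le zero_le_one]
  have : Complex.betaIntegral ((a + 1 : ℝ) : ℂ) ((b + 1 : ℝ) : ℂ) =
      ((∫ t in (0 : ℝ)..1, t ^ a * (1 - t) ^ b : ℝ) : ℂ) := by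
    rw [Complex.betaIntegral, ← intervalIntegral.integral_ofReal]
    refine intervalIntegral.integral_congr fun t ht => ?_
    rw [Set.uIcc_of_le zero_le_one] at ht
    have h1 : 0 ≤ 1 - t := sub_nonneg.2 ht.2
    simp [Complex.ofReal_cpow ht.1, Complex.ofReal_cpow h1]
  rw [this, Complex.ofReal_re]

lemma integral_cons_Splx {α : Fin (d + 2) → ℝ} {t : ℝ} (h0 : t ≠ 0) (h1 : t ≠ 1) :
    ∫ y : Fin d → ℝ, (Splx (d + 1)).indicator (fun x => ∏ a, xe x a ^ α a) (Fin.cons t y) =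
      (Set.Ioo (0 : ℝ) 1).indicator (fun t => t ^ α 0 * (1 - t) ^ ((∑ a, α (Fin.succ a)) + d)) t *
        ∫ z in Splx d, ∏ a, xe z a ^ α (Fin.succ a) := by
  have hsub : ∀ z : Fin d → ℝ, (Splx (d + 1)).indicator (fun x => ∏ a, xe x a ^ α a)
        (Fin.cons t ((1 - t) • z)) =
      (Set.Ioo (0 : ℝ) 1).indicator (fun t => t ^ α 0 * (1 - t) ^ (∑ a, α (Fin.succ a))) t *
        (Splx d).indicator (fun z => ∏ a, xe z a ^ α (Fin.succ a)) z := fun z => by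
    by_cases ht : t ∈ Set.Ioo (0 : ℝ) 1
    · have h1t : 0 < 1 - t := sub_pos.2 ht.2
      have hmem : (Fin.cons t ((1 - t) • z) : Fin (d + 1) → ℝ) ∈ Splx (d + 1) ↔ z ∈ Splx d := by
        rw [mem_Splx_iff, mem_Splx_iff, Fin.forall_fin_succ]
        simp only [xe_cons_zero, xe_cons_smul_succ, ht.1.le, true_and, mul_nonneg_iff_of_pos_left h1t]
      rw [Set.indicator_of_mem ht]
      by_cases hz : z ∈ Splx d
      · rw [Set.indicator_of_mem hz, Set.indicator_of_mem (hmem.2 hz), Fin.prod_univ_succ,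
          xe_cons_zero, Real.rpow_sum_of_pos h1t, mul_assoc, ← Finset.prod_mul_distrib]
        congr 1
        refine Finset.prod_congr rfl fun a _ => ?_
        rw [xe_cons_smul_succ, Real.mul_rpow h1t.le (mem_Splx_iff.1 hz a)]
      · rw [Set.indicator_of_notMem hz, Set.indicator_of_notMem (mt hmem.1 hz), mul_zero]
    · rw [Set.indicator_of_notMem ht, zero_mul, Set.indicator_of_notMem]
      intro h
      rw [mem_Splx_iff] at h
      have ht0 : 0 ≤ t := by simpa [xe_cons_zero] using h 0
      have hs := sum_xe (Fin.cons t ((1 - t) • z) : Fin (d + 1) → ℝ)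
      rw [Fin.sum_univ_succ, xe_cons_zero] at hs
      have := Finset.sum_nonneg fun a (_ : a ∈ Finset.univ) => h (Fin.succ a)
      exact ht ⟨lt_of_le_of_ne ht0 (Ne.symm h0), lt_of_le_of_ne (by linarith) h1⟩
  have hscale := Measure.integral_comp_smul (volume : Measure (Fin d → ℝ)) (fun y =>
    (Splx (d + 1)).indicator (fun x => ∏ a, xe x a ^ α a) (Fin.cons t y : Fin (d + 1) → ℝ)) (1 - t)
  simp only [hsub, integral_const_mul, integral_indicator isClosed_Splx.measurableSet,
    Module.finrank_fin_fun, smul_eq_mul] at hscale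
  have hne : 1 - t ≠ 0 := sub_ne_zero.2 (Ne.symm h1)
  by_cases ht : t ∈ Set.Ioo (0 : ℝ) 1
  · have h1t : 0 < 1 - t := sub_pos.2 ht.2
    rw [Set.indicator_of_mem ht] at hscale ⊢
    rw [Real.rpow_add_natCast hne]
    rw [abs_of_pos (by positivity)] at hscale
    field_simp at hscale
    linear_combination -hscale
  · rw [Set.indicator_of_notMem ht] at hscale ⊢
    rw [zero_mul] at hscale ⊢
    have : |((1 - t) ^ d)⁻¹| ≠ 0 := by simp [hne]
    exact (mul_eq_zero.1 hscale.symm).resolve_left this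

/-- Dirichlet's integral over the simplex. -/
lemma integral_Splx_prod_rpow (d : ℕ) {α : Fin (d + 1) → ℝ} (hα : ∀ a, 0 ≤ α a) :
    ∫ x in Splx d, ∏ a, xe x a ^ α a =
      (∏ a, Real.Gamma (α a + 1)) / Real.Gamma ((∑ a, α a) + d + 1) := by
  induction d with
  | zero =>
    have hu : Splx 0 = Set.univ := by ext x; simp [Splx]
    have hΓ : Real.Gamma (α 0 + 1) ≠ 0 := (Real.Gamma_pos_of_pos (by linarith [hα 0])).ne'
    have hxe : ∀ x : Fin 0 → ℝ, xe x 0 = 1 := fun x => by simp [xe]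
    simp [hu, hxe, hΓ, measureReal_def, volume_pi]
  | succ d ih =>
    set g : (Fin (d + 1) → ℝ) → ℝ := (Splx (d + 1)).indicator (fun x => ∏ a, xe x a ^ α a) with hg
    have hint : Integrable g := by
      rw [hg, integrable_indicator_iff isClosed_Splx.measurableSet]
      exact (continuous_prod_xe_rpow hα).continuousOn.integrableOn_compact isCompact_Splx
    have hmp := (volume_preserving_piFinSuccAbove (fun _ : Fin (d + 1) => ℝ) 0).symm
    rw [← integral_indicator isClosed_Splx.measurableSet, ← hg, ← hmp.integral_comp']
    have hint' : Integrable (fun p : ℝ × (Fin d → ℝ) =>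
        g ((MeasurableEquiv.piFinSuccAbove (fun _ => ℝ) 0).symm p)) (volume.prod volume) :=
      (hmp.integrable_comp_emb (MeasurableEquiv.measurableEmbedding _)).2 hint
    rw [Measure.volume_eq_prod, integral_prod _ hint']
    have hae : ∀ᵐ t : ℝ, t ≠ 0 ∧ t ≠ 1 := by
      have h0 : ∀ᵐ t : ℝ, t ≠ 0 := by simp [ae_iff]
      have h1 : ∀ᵐ t : ℝ, t ≠ 1 := by simp [ae_iff]
      exact h0.and h1
    have hinner : (fun t : ℝ => ∫ y : Fin d → ℝ,
        g ((MeasurableEquiv.piFinSuccAbove (fun _ : Fin (d + 1) => ℝ) 0).symm (t, y))) =ᵐ[volume]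
        fun t => (Set.Ioo (0 : ℝ) 1).indicator
          (fun t => t ^ α 0 * (1 - t) ^ ((∑ a, α (Fin.succ a)) + d)) t *
          ∫ z in Splx d, ∏ a, xe z a ^ α (Fin.succ a) := by
      filter_upwards [hae] with t ht
      rw [← integral_cons_Splx ht.1 ht.2]
      simp [hg, MeasurableEquiv.piFinSuccAbove_symm_apply, Fin.insertNthEquiv]
    have hs : 0 ≤ ∑ a, α (Fin.succ a) := Finset.sum_nonneg fun a _ => hα _
    have hΓ : Real.Gamma ((∑ a, α (Fin.succ a)) + d + 1) ≠ 0 :=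
      (Real.Gamma_pos_of_pos (by positivity)).ne'
    rw [integral_congr_ae hinner, integral_mul_const, integral_indicator measurableSet_Ioo,
      integral_rpow_mul_one_sub_rpow (hα 0) (by positivity), ih fun a => hα _,
      Fin.prod_univ_succ (fun a => Real.Gamma (α a + 1)), Fin.sum_univ_succ α]
    push_cast
    rw [show α 0 + ((∑ a, α (Fin.succ a)) + d) + 2 =
      α 0 + (∑ a, α (Fin.succ a)) + (d + 1) + 1 by ring]
    field_simp

end Simplex

section Functional

open MvPolynomial

variable {d : ℕ}

lemma continuous_eval_xe (P : MvPolynomial (Fin (d + 1)) ℝ) :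
    Continuous fun x : Fin d → ℝ => eval (xe x) P :=
  (MvPolynomial.continuous_eval P).comp (continuous_pi continuous_xe)

lemma Wk_nonneg (κ : Fin (d + 1) → ℝ) {x : Fin d → ℝ} (hx : x ∈ Splx d) : 0 ≤ Wk κ x := by
  rw [Wk_eq_prod]
  exact Finset.prod_nonneg fun a _ => Real.rpow_nonneg (mem_Splx_iff.1 hx a) _

lemma integrableOn_eval_xe_mul_Wk {κ : Fin (d + 1) → ℝ} (hκ : ∀ i, 0 ≤ κ i)
    (P : MvPolynomial (Fin (d + 1)) ℝ) :
    IntegrableOn (fun x => eval (xe x) P * Wk κ x) (Splx d) := by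
  refine ((continuous_eval_xe P).mul ?_).continuousOn.integrableOn_compact isCompact_Splx
  exact (continuous_prod_xe_rpow hκ).congr fun x => (Wk_eq_prod κ x).symm

/-- Integration of polynomials in barycentric coordinates against the Jacobi weight. -/
def simplexIntegral {κ : Fin (d + 1) → ℝ} (hκ : ∀ i, 0 ≤ κ i) :
    MvPolynomial (Fin (d + 1)) ℝ →ₗ[ℝ] ℝ where
  toFun P := ∫ x in Splx d, eval (xe x) P * Wk κ x
  map_add' P Q := by
    rw [← integral_add (integrableOn_eval_xe_mul_Wk hκ P) (integrableOn_eval_xe_mul_Wk hκ Q)]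
    simp only [map_add, add_mul]
  map_smul' c P := by
    rw [RingHom.id_apply, smul_eq_mul, ← integral_const_mul]
    simp only [smul_eval, mul_assoc]

variable {κ : Fin (d + 1) → ℝ} (hκ : ∀ i, 0 ≤ κ i)

lemma simplexIntegral_apply (P : MvPolynomial (Fin (d + 1)) ℝ) :
    simplexIntegral hκ P = ∫ x in Splx d, eval (xe x) P * Wk κ x := rfl

lemma simplexIntegral_mul_self_nonneg (P : MvPolynomial (Fin (d + 1)) ℝ) :
    0 ≤ simplexIntegral hκ (P * P) :=
  setIntegral_nonneg isClosed_Splx.measurableSet fun x hx => by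
    rw [map_mul]
    exact mul_nonneg (mul_self_nonneg _) (Wk_nonneg κ hx)

lemma simplexIntegral_coordSum_mul (P : MvPolynomial (Fin (d + 1)) ℝ) :
    simplexIntegral hκ (coordSum (Fin (d + 1)) * P) = simplexIntegral hκ P := by
  simp [simplexIntegral_apply, coordSum, sum_xe]

lemma simplexIntegral_monomial (m : Fin (d + 1) →₀ ℕ) :
    simplexIntegral hκ (monomial m 1) =
      (∏ a, Real.Gamma (κ a + m a + 1)) / Real.Gamma ((∑ a, κ a) + m.degree + d + 1) := by
  have h := integral_Splx_prod_rpow d (α := fun a => κ a + m a)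
    fun a => add_nonneg (hκ a) (Nat.cast_nonneg _)
  have hdeg : ((m.degree : ℕ) : ℝ) = ∑ a, (m a : ℝ) := by
    rw [Finsupp.degree_eq_sum, Nat.cast_sum]
  rw [hdeg, ← Finset.sum_add_distrib, ← h, simplexIntegral_apply]
  refine setIntegral_congr_fun isClosed_Splx.measurableSet fun x hx => ?_
  simp only [eval_monomial, one_mul, Wk_eq_prod,
    Finsupp.prod_fintype _ _ (fun a => pow_zero (xe x a)), ← Finset.prod_mul_distrib]
  refine Finset.prod_congr rfl fun a _ => ?_
  rw [Real.rpow_add_of_nonneg (mem_Splx_iff.1 hx a) (hκ a) (Nat.cast_nonneg _),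
    Real.rpow_natCast, mul_comm]

lemma simplexIntegral_X_mul_monomial (a : Fin (d + 1)) (m : Fin (d + 1) →₀ ℕ) :
    ((∑ b, κ b) + m.degree + Fintype.card (Fin (d + 1))) *
      simplexIntegral hκ (X a * monomial m 1) =
        (κ a + m a + 1) * simplexIntegral hκ (monomial m 1) := by
  have hX : X a * monomial m (1 : ℝ) = monomial (m + Finsupp.single a 1) 1 := by
    rw [X, monomial_mul, one_mul, add_comm m]
  have hsum : 0 ≤ ∑ b, κ b := Finset.sum_nonneg fun b _ => hκ b
  have hc : 0 < (∑ b, κ b) + (m.degree : ℝ) + d + 1 := by positivity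
  have hca : 0 < κ a + (m a : ℝ) + 1 := by have := hκ a; positivity
  have hΓ := (Real.Gamma_pos_of_pos hc).ne'
  rw [hX, simplexIntegral_monomial, simplexIntegral_monomial,
    ← Finset.mul_prod_erase _ _ (Finset.mem_univ a),
    ← Finset.mul_prod_erase (s := Finset.univ) (fun a => Real.Gamma (κ a + m a + 1))
      (Finset.mem_univ a)]
  have herase : ∏ b ∈ Finset.univ.erase a, Real.Gamma (κ b + (m + Finsupp.single a 1 : _ →₀ ℕ) b + 1) =
      ∏ b ∈ Finset.univ.erase a, Real.Gamma (κ b + m b + 1) :=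
    Finset.prod_congr rfl fun b hb => by
      simp [Finsupp.single_eq_of_ne (Finset.ne_of_mem_erase hb)]
  rw [herase]
  have e1 : κ a + ((m + Finsupp.single a 1 : _ →₀ ℕ) a : ℝ) + 1 = (κ a + m a + 1) + 1 := by
    simp only [Finsupp.add_apply, Finsupp.single_eq_same]; push_cast; ring
  have e2 : (∑ b, κ b) + ((m + Finsupp.single a 1).degree : ℝ) + d + 1 =
      ((∑ b, κ b) + m.degree + d + 1) + 1 := by
    rw [map_add, Finsupp.degree_single]; push_cast; ring
  rw [e1, e2, Real.Gamma_add_one hca.ne', Real.Gamma_add_one hc.ne', Fintype.card_fin]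
  push_cast
  field_simp
  ring

end Functional

section Bernstein

open MvPolynomial

variable {d : ℕ}

lemma exists_homogenization {n : ℕ} {f : MvPolynomial (Fin d) ℝ} (hf : f.totalDegree ≤ n) :
    ∃ F : MvPolynomial (Fin (d + 1)) ℝ, F.IsHomogeneous n ∧
      ∀ x : Fin d → ℝ, eval (xe x) F = eval x f := by
  refine ⟨∑ k ∈ Finset.range (n + 1),
    coordSum _ ^ (n - k) * rename Fin.castSucc (homogeneousComponent k f), ?_, fun x => ?_⟩
  · refine IsHomogeneous.sum _ _ _ fun k hk => ?_
    have h := (coordSum_isHomogeneous (σ := Fin (d + 1))).pow (n - k) |>.mul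
      ((homogeneousComponent_isHomogeneous k f).rename_isHomogeneous (f := Fin.castSucc))
    have hk' : k ≤ n := Nat.lt_succ_iff.1 (Finset.mem_range.1 hk)
    rwa [one_mul, Nat.sub_add_cancel hk'] at h
  · have hcomp : xe x ∘ Fin.castSucc = x := funext fun i => xe_castSucc x i
    have hS : eval (xe x) (coordSum (Fin (d + 1))) = 1 := by simp [coordSum, sum_xe]
    simp only [map_sum, map_mul, map_pow, hS, one_pow, one_mul, eval_rename, hcomp]
    rw [← map_sum]
    congr 1
    conv_rhs => rw [← sum_homogeneousComponent f]
    symm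
    refine Finset.sum_subset (Finset.range_mono (by lia)) fun k _ hk => ?_
    exact homogeneousComponent_eq_zero _ _ (by simpa using hk)

lemma hasFDerivAt_eval {ι : Type*} [Fintype ι] (P : MvPolynomial ι ℝ) (y : ι → ℝ) :
    HasFDerivAt (fun z => eval z P)
      (∑ a, eval y (pderiv a P) • (ContinuousLinearMap.proj a : (ι → ℝ) →L[ℝ] ℝ)) y := by
  classical
  induction P using MvPolynomial.induction_on with
  | C c => simpa using hasFDerivAt_const c y
  | add P Q hP hQ =>
    simpa only [map_add, add_smul, Finset.sum_add_distrib] using hP.fun_add hQ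
  | mul_X P i hP =>
    have h := hP.mul (hasFDerivAt_apply i y)
    simp only [map_mul, eval_X]
    refine h.congr_fderiv ?_
    ext v
    simp only [pderiv_mul, pderiv_X, add_apply, smul_apply,
      _root_.sum_apply, ContinuousLinearMap.proj_apply, smul_eq_mul, map_add,
      map_mul, eval_X, add_mul, Finset.sum_add_distrib, Finset.mul_sum]
    rw [add_comm]
    congr 1
    · exact Finset.sum_congr rfl fun _ _ => by ring
    · simp [Pi.single_apply, apply_ite (eval y)]

lemma pd_eval_xe (F : MvPolynomial (Fin (d + 1)) ℝ) (i : Fin d) (x : Fin d → ℝ) :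
    pd i (fun y => eval (xe y) F) x =
      eval (xe x) (pderiv i.castSucc F) - eval (xe x) (pderiv (Fin.last d) F) := by
  let L : Fin (d + 1) → (Fin d → ℝ) →L[ℝ] ℝ :=
    Fin.lastCases (-∑ j, ContinuousLinearMap.proj j) fun j => ContinuousLinearMap.proj j
  have hL : HasFDerivAt (fun y : Fin d → ℝ => xe y) (ContinuousLinearMap.pi L) x := by
    rw [hasFDerivAt_pi]
    refine Fin.lastCases ?_ fun j => ?_
    · simp only [xe_last, L, Fin.lastCases_last]
      exact (HasFDerivAt.fun_sum fun j _ => hasFDerivAt_apply j x).const_sub 1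
    · simp only [xe_castSucc, L, Fin.lastCases_castSucc]
      exact hasFDerivAt_apply j x
  have h : HasFDerivAt (fun y => eval (xe y) F) _ x := (hasFDerivAt_eval F (xe x)).comp x hL
  rw [pd, HasFDerivAt.fderiv h]
  simp [Fin.sum_univ_castSucc, L, Pi.single_apply, sub_eq_add_neg]

lemma sq_sqrt_mul_sub_le {ι : Type*} [Fintype ι] {y : ι → ℝ} (hy : ∀ c, 0 ≤ y c)
    (hsum : ∑ c, y c = 1) (g : ι → ℝ) {a b l : ι} (hab : a ≠ b) (hla : l ≠ a) (hlb : l ≠ b) :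
    (√(y a * y b) / √(1 - y l) * (g a - g b)) ^ 2 ≤
      ∑ c, y c * g c ^ 2 - (∑ c, y c * g c) ^ 2 := by
  classical
  set M := ∑ c, y c * g c with hM
  have hvar : ∑ c, y c * g c ^ 2 - M ^ 2 = ∑ c, y c * (g c - M) ^ 2 := by
    have e : ∀ c, y c * (g c - M) ^ 2 = y c * g c ^ 2 - 2 * M * (y c * g c) + M ^ 2 * y c :=
      fun c => by ring
    simp only [e, Finset.sum_add_distrib, Finset.sum_sub_distrib, ← Finset.mul_sum, hsum, ← hM]
    ring
  have hpair : y a * (g a - M) ^ 2 + y b * (g b - M) ^ 2 ≤ ∑ c, y c * (g c - M) ^ 2 := by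
    rw [← Finset.sum_pair (f := fun c => y c * (g c - M) ^ 2) hab]
    exact Finset.sum_le_sum_of_subset_of_nonneg (Finset.subset_univ _)
      fun c _ _ => mul_nonneg (hy c) (sq_nonneg _)
  have htriple : y l + (y a + y b) ≤ 1 := by
    rw [← hsum, ← Finset.sum_pair hab, ← Finset.sum_insert (by simp [hla, hlb])]
    exact Finset.sum_le_sum_of_subset_of_nonneg (Finset.subset_univ _) fun c _ _ => hy c
  rw [hvar]
  refine le_trans ?_ hpair
  have ha := hy a
  have hb := hy b
  have hnn : 0 ≤ y a * (g a - M) ^ 2 + y b * (g b - M) ^ 2 := by positivity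
  have hl : 0 ≤ 1 - y l := by linarith
  rw [mul_pow, div_pow, Real.sq_sqrt (mul_nonneg ha hb), Real.sq_sqrt hl, div_mul_eq_mul_div]
  refine div_le_of_le_mul₀ hl hnn ?_
  calc y a * y b * (g a - g b) ^ 2
      ≤ (y a * (g a - M) ^ 2 + y b * (g b - M) ^ 2) * (y a + y b) := by
        nlinarith [sq_nonneg (y a * (g a - M) + y b * (g b - M))]
    _ ≤ _ := mul_le_mul_of_nonneg_left (by linarith) hnn

lemma nrm2_bary_diff_le {κ : Fin (d + 1) → ℝ} (hκ : ∀ i, 0 ≤ κ i) {n : ℕ}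
    {F : MvPolynomial (Fin (d + 1)) ℝ} (hF : F.IsHomogeneous n) {a b l : Fin (d + 1)}
    (hab : a ≠ b) (hla : l ≠ a) (hlb : l ≠ b) :
    nrm2 κ (fun x => √(xe x a * xe x b) / √(1 - xe x l) *
        (eval (xe x) (pderiv a F) - eval (xe x) (pderiv b F))) ≤
      √((n : ℝ) * ((n : ℝ) + (∑ k, κ k) + (d : ℝ))) * nrm2 κ (fun x => eval (xe x) F) := by
  have hsum : 0 ≤ ∑ k, κ k := Finset.sum_nonneg fun k _ => hκ k
  have hb : 0 ≤ bk κ := div_nonneg (Real.Gamma_nonneg_of_nonneg (by positivity))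
    (Finset.prod_nonneg fun k _ => Real.Gamma_nonneg_of_nonneg (by linarith [hκ k]))
  rw [nrm2, nrm2, ← Real.sqrt_mul (by positivity)]
  refine Real.sqrt_le_sqrt ?_
  rw [ipk, ipk, mul_left_comm]
  refine mul_le_mul_of_nonneg_left ?_ hb
  have heval : ∀ x : Fin d → ℝ, eval (xe x) (carre F F - C ((n : ℝ) ^ 2) * (F * F)) =
      ∑ c, xe x c * eval (xe x) (pderiv c F) ^ 2 -
        (∑ c, xe x c * eval (xe x) (pderiv c F)) ^ 2 := fun x => by
    have euler := congrArg (eval (xe x)) hF.sum_X_mul_pderiv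
    simp only [map_sum, map_mul, eval_X, nsmul_eq_mul, map_natCast] at euler
    rw [euler]
    simp only [carre, map_sub, map_sum, map_mul, eval_X, eval_C]
    congr 1
    · exact Finset.sum_congr rfl fun _ _ => by ring
    · ring
  have hle := E_carre_self_le (simplexIntegral_X_mul_monomial hκ) hκ
    (simplexIntegral_mul_self_nonneg hκ) (simplexIntegral_coordSum_mul hκ) hF
  calc _ ≤ simplexIntegral hκ (carre F F - C ((n : ℝ) ^ 2) * (F * F)) := by
        refine integral_mono_of_nonneg ?_ (integrableOn_eval_xe_mul_Wk hκ _) ?_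
        · filter_upwards [ae_restrict_mem isClosed_Splx.measurableSet] with x hx
          exact mul_nonneg (mul_self_nonneg _) (Wk_nonneg κ hx)
        · filter_upwards [ae_restrict_mem isClosed_Splx.measurableSet] with x hx
          refine mul_le_mul_of_nonneg_right ?_ (Wk_nonneg κ hx)
          rw [heval, ← sq]
          exact sq_sqrt_mul_sub_le (mem_Splx_iff.1 hx) (sum_xe x)
            (fun c => eval (xe x) (pderiv c F)) hab hla hlb
    _ ≤ n * (n + (∑ k, κ k) + d) * simplexIntegral hκ (F * F) := by
        rw [map_sub, ← smul_eq_C_mul, map_smul, smul_eq_mul]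
        rw [Fintype.card_fin] at hle
        push_cast at hle
        linarith
    _ = _ := by simp only [simplexIntegral_apply, map_mul]

end Bernstein

/-- the inequalities \eqref{eq:B-ineq3} and \eqref{eq:B-ineq4}; the maximum over
`ℓ` is expressed as a universal quantification over the admissible `ℓ`. -/
theorem stmt15 (d : ℕ) (hd : 2 ≤ d) (κ : Fin (d+1) → ℝ) (hκ : ∀ i, 0 ≤ κ i)
    (n : ℕ) (f : MvPolynomial (Fin d) ℝ) (hf : f.totalDegree ≤ n) :
    (∀ i l : Fin d, l ≠ i →
      nrm2 κ (fun x => Real.sqrt (x i * (1 - ∑ k, x k)) / Real.sqrt (1 - x l) *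
          pd i (fun y => MvPolynomial.eval y f) x) ≤
        Real.sqrt ((n : ℝ) * ((n : ℝ) + (∑ k, κ k) + (d : ℝ))) *
          nrm2 κ (fun x => MvPolynomial.eval x f)) ∧
    (∀ i j : Fin d, i < j → ∀ l : Fin (d+1), l ≠ i.castSucc → l ≠ j.castSucc →
      nrm2 κ (fun x => Real.sqrt (x i * x j) / Real.sqrt (1 - xe x l) *
          pdd i j (fun y => MvPolynomial.eval y f) x) ≤
        Real.sqrt ((n : ℝ) * ((n : ℝ) + (∑ k, κ k) + (d : ℝ))) *
          nrm2 κ (fun x => MvPolynomial.eval x f)) := by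
  obtain ⟨F, hF, hfF⟩ := exists_homogenization hf
  have hpd : ∀ i x, pd i (fun y => MvPolynomial.eval y f) x =
      MvPolynomial.eval (xe x) (MvPolynomial.pderiv i.castSucc F) -
        MvPolynomial.eval (xe x) (MvPolynomial.pderiv (Fin.last d) F) := fun i x => by
    simp only [← hfF, pd_eval_xe]
  refine ⟨fun i l hl => ?_, fun i j hij l hli hlj => ?_⟩
  · have h := nrm2_bary_diff_le hκ hF (Fin.castSucc_lt_last i).ne
      (mt (Fin.castSucc_injective d).eq_iff.1 hl) (Fin.castSucc_lt_last l).ne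
    simpa only [xe_castSucc, xe_last, hpd, hfF] using h
  · have h := nrm2_bary_diff_le hκ hF (mt (Fin.castSucc_injective d).eq_iff.1 hij.ne) hli hlj
    simpa only [xe_castSucc, pdd, hpd, hfF, sub_sub_sub_cancel_right] using h
end
end

section
/- Let d ≥ 2, let w be a doubling weight on △^d, let r ∈ ℕ and 1 ≤ p < ∞. Then there exists a constant c > 0, depending only on w, d, p and r, such that for all n ∈ ℕ and all polynomials f in d variables of degree at most n: (a) ‖ φ_i^r ∂_i^r f ‖_{w,p} ≤ c n^r ‖f‖_{w,p} for 1 ≤ i ≤ d, where φ_i(x) = √(x_i)√(1−|x|)/√(x_i + 1 − |x|); and (b) ‖ φ_{i,j}^r ∂_{i,j}^r f ‖_{w,p} ≤ c n^r ‖f‖_{w,p} for 1 ≤ i < j ≤ d, where φ_{i,j}(x) = √(x_i)√(x_j)/√(x_i + x_j). -/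
open MeasureTheory Finset

noncomputable section

/-- The distance `d_△(x,y) = arccos(Σ_{i=1}^{d+1} √(x_i) √(y_i))` on the simplex. -/
def dT {d : ℕ} (x y : Fin d → ℝ) : ℝ :=
  Real.arccos ((∑ i, Real.sqrt (x i) * Real.sqrt (y i)) +
    Real.sqrt (1 - ∑ i, x i) * Real.sqrt (1 - ∑ i, y i))

/-- The ball `B(x,r)` of the metric `d_△` inside the simplex. -/
def ballT {d : ℕ} (x : Fin d → ℝ) (r : ℝ) : Set (Fin d → ℝ) :=
  {y ∈ Splx d | dT x y ≤ r}

/-- A doubling weight on the simplex: a nonnegative integrable function `w` such that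
`w(B(x,2r)) ≤ c_w w(B(x,r))` uniformly in `x` and `r`. -/
def IsDoubling {d : ℕ} (w : (Fin d → ℝ) → ℝ) : Prop :=
  (∀ x, 0 ≤ w x) ∧ MeasureTheory.IntegrableOn w (Splx d) ∧
    ∃ cw > 0, ∀ x ∈ Splx d, ∀ r : ℝ, 0 < r →
      (∫ y in ballT x (2 * r), w y) ≤ cw * ∫ y in ballT x r, w y


/-- `g` is a trigonometric polynomial of degree at most `N`, written through an algebraic
polynomial in `exp (θ * I)`. -/
def IsTrig (N : ℕ) (g : ℝ → ℝ) : Prop :=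
  ∃ P : Polynomial ℂ, P.natDegree ≤ 2 * N ∧
    ∀ θ : ℝ, P.eval (Complex.exp (θ * Complex.I)) = Complex.exp (θ * Complex.I) ^ N * (g θ : ℂ)

namespace IsTrig

lemma const (c : ℝ) : IsTrig 0 (fun _ => c) :=
  ⟨Polynomial.C (c : ℂ), by simp, fun θ => by simp⟩

lemma mul {M N : ℕ} {f g : ℝ → ℝ} (hf : IsTrig M f) (hg : IsTrig N g) :
    IsTrig (M + N) (fun θ => f θ * g θ) := by
  obtain ⟨P, hP, hPe⟩ := hf
  obtain ⟨Q, hQ, hQe⟩ := hg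
  refine ⟨P * Q, Polynomial.natDegree_mul_le.trans (by omega), fun θ => ?_⟩
  rw [Polynomial.eval_mul, hPe, hQe]
  push_cast
  ring

lemma add {N : ℕ} {f g : ℝ → ℝ} (hf : IsTrig N f) (hg : IsTrig N g) :
    IsTrig N (fun θ => f θ + g θ) := by
  obtain ⟨P, hP, hPe⟩ := hf
  obtain ⟨Q, hQ, hQe⟩ := hg
  refine ⟨P + Q, Polynomial.natDegree_add_le_of_degree_le hP hQ, fun θ => ?_⟩
  rw [Polynomial.eval_add, hPe, hQe]
  push_cast
  ring

lemma mono {M N : ℕ} (h : M ≤ N) {f : ℝ → ℝ} (hf : IsTrig M f) : IsTrig N f := by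
  obtain ⟨P, hP, hPe⟩ := hf
  refine ⟨Polynomial.X ^ (N - M) * P, Polynomial.natDegree_mul_le.trans ?_, fun θ => ?_⟩
  · rw [Polynomial.natDegree_X_pow]
    omega
  · rw [Polynomial.eval_mul, hPe, Polynomial.eval_pow, Polynomial.eval_X, ← mul_assoc, ← pow_add,
      Nat.sub_add_cancel h]

lemma cos : IsTrig 1 Real.cos := by
  refine ⟨Polynomial.C (1 / 2) * (Polynomial.X ^ 2 + 1), by compute_degree, fun θ => ?_⟩
  have h : Complex.exp (θ * Complex.I) * Complex.exp (-θ * Complex.I) = 1 := by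
    rw [← Complex.exp_add]
    simp
  simp only [Polynomial.eval_mul, Polynomial.eval_C, Polynomial.eval_add, Polynomial.eval_pow,
    Polynomial.eval_X, Polynomial.eval_one, Complex.ofReal_cos, Complex.cos]
  linear_combination (-1 / 2) * h

lemma sin : IsTrig 1 Real.sin := by
  refine ⟨Polynomial.C (-Complex.I / 2) * (Polynomial.X ^ 2 - 1), by compute_degree, fun θ => ?_⟩
  have h : Complex.exp (θ * Complex.I) * Complex.exp (-θ * Complex.I) = 1 := by
    rw [← Complex.exp_add]
    simp
  simp only [Polynomial.eval_mul, Polynomial.eval_C, Polynomial.eval_sub, Polynomial.eval_pow,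
    Polynomial.eval_X, Polynomial.eval_one, Complex.ofReal_sin, Complex.sin]
  linear_combination (-Complex.I / 2) * h

/-- A polynomial of degree at most `N` bounded by `A` on the unit circle is bounded by
`A * R ^ N` on the disc of radius `R ≥ 1`. -/
lemma norm_eval_le_of_circle {N : ℕ} {P : Polynomial ℂ} (hP : P.natDegree ≤ N) {A : ℝ}
    (hA : ∀ z : ℂ, ‖z‖ = 1 → ‖P.eval z‖ ≤ A) {R : ℝ} (hR : 1 ≤ R) {z : ℂ} (hz : ‖z‖ ≤ R) :
    ‖P.eval z‖ ≤ A * R ^ N := by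
  have key : ∀ Q : Polynomial ℂ, (∀ w : ℂ, ‖w‖ = 1 → ‖Q.eval w‖ ≤ A) →
      ∀ w : ℂ, ‖w‖ ≤ 1 → ‖Q.eval w‖ ≤ A := by
    intro Q hQ w hw
    refine Complex.norm_le_of_forall_mem_frontier_norm_le (U := Metric.ball (0 : ℂ) 1)
      Metric.isBounded_ball (f := fun w => Q.eval w) Q.differentiable.diffContOnCl ?_ ?_
    · intro v hv
      rw [frontier_ball _ one_ne_zero] at hv
      exact hQ v (by simpa using hv)
    · rw [closure_ball _ one_ne_zero]
      simpa using hw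
  have hA0 : 0 ≤ A := (norm_nonneg _).trans (hA 1 (by simp))
  rcases le_total ‖z‖ 1 with h | h
  · exact (key P hA z h).trans (le_mul_of_one_le_right hA0 (one_le_pow₀ hR))
  · have hrefl : ∀ w : ℂ, w ≠ 0 → ‖P.eval w‖ = ‖(Polynomial.reflect N P).eval w⁻¹‖ * ‖w‖ ^ N := by
      intro w hw
      let _ := invertibleOfNonzero hw
      have := Polynomial.eval₂_reflect_mul_pow (RingHom.id ℂ) w N P hP
      rw [← norm_pow, ← norm_mul, Polynomial.eval, Polynomial.eval, ← this, invOf_eq_inv]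
    have hz0 : z ≠ 0 := norm_pos_iff.mp (by linarith)
    rw [hrefl z hz0]
    refine mul_le_mul (key _ ?_ _ ?_) (pow_le_pow_left₀ (norm_nonneg _) hz N) (by positivity) hA0
    · intro w hw
      have hw0 : w ≠ 0 := norm_pos_iff.mp (by rw [hw]; exact one_pos)
      have h2 := hrefl w⁻¹ (inv_ne_zero hw0)
      have h3 : ‖w⁻¹‖ = 1 := by rw [norm_inv, hw, inv_one]
      rw [inv_inv, h3, one_pow, mul_one] at h2
      rw [← h2]
      exact hA _ h3
    · rw [norm_inv]
      exact inv_le_one_of_one_le₀ h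

/-- Bernstein's inequality for trigonometric polynomials, in Lipschitz form. -/
lemma abs_sub_le {N : ℕ} (hN : 0 < N) {g : ℝ → ℝ} (hg : IsTrig N g) {A : ℝ}
    (hA : ∀ θ, |g θ| ≤ A) (a b : ℝ) : |g a - g b| ≤ 10 * N * A * |a - b| := by
  obtain ⟨P, hP, hPe⟩ := hg
  have hN0 : (0 : ℝ) < N := by exact_mod_cast hN
  have hA0 : 0 ≤ A := (abs_nonneg _).trans (hA 0)
  have hcirc : ∀ z : ℂ, ‖z‖ = 1 → ‖P.eval z‖ ≤ A := by
    intro z hz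
    have h1 : Complex.exp (z.arg * Complex.I) = z := by
      have := Complex.norm_mul_exp_arg_mul_I z
      rwa [hz, Complex.ofReal_one, one_mul] at this
    rw [← h1, hPe, norm_mul, norm_pow, h1, hz, one_pow, one_mul, Complex.norm_real]
    exact hA _
  have hderiv : ∀ z : ℂ, ‖z‖ = 1 → ‖P.derivative.eval z‖ ≤ 9 * N * A := by
    intro z hz
    have hb : ∀ w ∈ Metric.sphere z (1 / (N : ℝ)), ‖P.eval w‖ ≤ A * (1 + 1 / (N : ℝ)) ^ (2 * N) := by
      intro w hw
      refine norm_eval_le_of_circle hP hcirc (by simp) ?_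
      have h1 : ‖w - z‖ = 1 / (N : ℝ) := by simpa [dist_eq_norm] using hw
      calc ‖w‖ = ‖z + (w - z)‖ := by rw [add_sub_cancel]
        _ ≤ ‖z‖ + ‖w - z‖ := norm_add_le _ _
        _ = 1 + 1 / (N : ℝ) := by rw [hz, h1]
    have h := Complex.norm_deriv_le_of_forall_mem_sphere_norm_le (f := fun w => P.eval w)
      (by positivity : 0 < 1 / (N : ℝ)) P.differentiable.diffContOnCl hb
    rw [Polynomial.deriv] at h
    refine h.trans ?_
    have h2 : (1 + 1 / (N : ℝ)) ^ (2 * N) ≤ 9 := by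
      have h3 : (1 + 1 / (N : ℝ)) ^ N ≤ Real.exp 1 := by
        have h4 := Real.add_one_le_exp (1 / (N : ℝ))
        calc (1 + 1 / (N : ℝ)) ^ N ≤ (Real.exp (1 / N)) ^ N :=
              pow_le_pow_left₀ (by positivity) (by linarith) N
          _ = Real.exp 1 := by rw [← Real.exp_nat_mul]; congr 1; field_simp
      have h5 : Real.exp 1 ≤ 3 := by linarith [Real.exp_one_lt_d9]
      rw [mul_comm, pow_mul]
      nlinarith [pow_nonneg (by positivity : 0 ≤ 1 + 1 / (N : ℝ)) N]
    rw [div_div_eq_mul_div, div_one]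
    nlinarith [mul_le_mul_of_nonneg_left h2 (mul_nonneg hA0 hN0.le)]
  have hd : ∀ θ : ℝ, HasDerivAt (fun t : ℝ => ((g t : ℝ) : ℂ))
      (Complex.exp (θ * Complex.I) ^ N * ((-N * Complex.I) * g θ) * (Complex.exp (θ * Complex.I))⁻¹ ^ N
      + (Complex.exp (θ * Complex.I))⁻¹ ^ N * (P.derivative.eval (Complex.exp (θ * Complex.I)) *
        (Complex.exp (θ * Complex.I) * Complex.I))) θ := by
    intro θ
    have he : ∀ c : ℂ, HasDerivAt (fun t : ℝ => Complex.exp (t * c)) (Complex.exp (θ * c) * c) θ := by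
      intro c
      have h1 : HasDerivAt (fun t : ℝ => (t : ℂ) * c) c θ := by
        simpa using (Complex.ofRealCLM.hasDerivAt (x := θ)).mul_const c
      exact h1.cexp
    have hform : (fun t : ℝ => ((g t : ℝ) : ℂ)) = fun t : ℝ =>
        Complex.exp (t * (-N * Complex.I)) * P.eval (Complex.exp (t * Complex.I)) := by
      funext t
      rw [hPe, ← mul_assoc, ← Complex.exp_nat_mul, ← Complex.exp_add]
      rw [show (t : ℂ) * (-N * Complex.I) + N * (t * Complex.I) = 0 by ring]
      simp
    have hne := Complex.exp_ne_zero (θ * Complex.I)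
    have hpow : Complex.exp (θ * (-N * Complex.I)) = (Complex.exp (θ * Complex.I))⁻¹ ^ N := by
      rw [← Complex.exp_neg, ← Complex.exp_nat_mul]
      congr 1
      ring
    rw [hform]
    have h2 := (he (-N * Complex.I)).mul
      ((P.hasDerivAt (Complex.exp (θ * Complex.I))).comp θ (he Complex.I))
    refine h2.congr_deriv ?_
    simp only [Function.comp]
    rw [hpow, hPe]
    ring
  have hbd : ∀ θ : ℝ, ‖Complex.exp (θ * Complex.I) ^ N * ((-N * Complex.I) * g θ) *
        (Complex.exp (θ * Complex.I))⁻¹ ^ N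
      + (Complex.exp (θ * Complex.I))⁻¹ ^ N * (P.derivative.eval (Complex.exp (θ * Complex.I)) *
        (Complex.exp (θ * Complex.I) * Complex.I))‖ ≤ 10 * N * A := by
    intro θ
    have h1 : ‖Complex.exp (θ * Complex.I)‖ = 1 := Complex.norm_exp_ofReal_mul_I θ
    refine (norm_add_le _ _).trans ?_
    simp only [norm_mul, norm_pow, norm_inv, h1, Complex.norm_I, norm_neg, Complex.norm_natCast,
      Complex.norm_real, Real.norm_eq_abs, one_pow, inv_one, mul_one, one_mul]
    have h3 := mul_le_mul_of_nonneg_left (hA θ) hN0.le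
    linarith [hderiv _ h1]
  have h := Convex.norm_image_sub_le_of_norm_hasDerivWithin_le (s := Set.univ)
    (fun θ _ => (hd θ).hasDerivWithinAt) (fun θ _ => hbd θ) convex_univ
    (Set.mem_univ b) (Set.mem_univ a)
  rwa [← Complex.ofReal_sub, Complex.norm_real, Real.norm_eq_abs, Real.norm_eq_abs] at h

end IsTrig

/-- A function on a Euclidean space whose restriction to every great circle of the unit sphere is
a trigonometric polynomial of degree at most `N`. -/
def IsSph {E : Type*} [NormedAddCommGroup E] [InnerProductSpace ℝ E] (N : ℕ) (G : E → ℝ) : Prop :=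
  ∀ y e : E, ‖y‖ = 1 → ‖e‖ = 1 → inner ℝ y e = 0 →
    IsTrig N (fun θ => G (Real.cos θ • y + Real.sin θ • e))

namespace IsSph

variable {E : Type*} [NormedAddCommGroup E] [InnerProductSpace ℝ E]

lemma const (c : ℝ) : IsSph 0 (fun _ : E => c) :=
  fun _ _ _ _ _ => IsTrig.const c

lemma mul {M N : ℕ} {f g : E → ℝ} (hf : IsSph M f) (hg : IsSph N g) :
    IsSph (M + N) (fun u => f u * g u) :=
  fun y e hy he hye => (hf y e hy he hye).mul (hg y e hy he hye)

lemma add {N : ℕ} {f g : E → ℝ} (hf : IsSph N f) (hg : IsSph N g) :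
    IsSph N (fun u => f u + g u) :=
  fun y e hy he hye => (hf y e hy he hye).add (hg y e hy he hye)

lemma mono {M N : ℕ} (h : M ≤ N) {f : E → ℝ} (hf : IsSph M f) : IsSph N f :=
  fun y e hy he hye => (hf y e hy he hye).mono h

lemma pow {N : ℕ} {f : E → ℝ} (hf : IsSph N f) (k : ℕ) : IsSph (k * N) (fun u => f u ^ k) := by
  induction k with
  | zero => simpa using const 1
  | succ k ih =>
    rw [Nat.succ_mul]
    simpa only [pow_succ] using ih.mul hf

lemma sum {N : ℕ} {ι : Type*} (s : Finset ι) {f : ι → E → ℝ} (hf : ∀ i ∈ s, IsSph N (f i)) :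
    IsSph N (fun u => ∑ i ∈ s, f i u) := by
  classical
  induction s using Finset.induction_on with
  | empty => simpa using (const (E := E) 0).mono (Nat.zero_le N)
  | insert a s ha ih =>
    simp only [Finset.sum_insert ha]
    exact (hf a (Finset.mem_insert_self a s)).add
      (ih fun i hi => hf i (Finset.mem_insert_of_mem hi))

lemma prod {ι : Type*} (s : Finset ι) {f : ι → E → ℝ} {N : ι → ℕ}
    (hf : ∀ i ∈ s, IsSph (N i) (f i)) :
    IsSph (∑ i ∈ s, N i) (fun u => ∏ i ∈ s, f i u) := by
  classical
  induction s using Finset.induction_on with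
  | empty => simpa using const (E := E) 1
  | insert a s ha ih =>
    simp only [Finset.prod_insert ha, Finset.sum_insert ha]
    exact (hf a (Finset.mem_insert_self a s)).mul
      (ih fun i hi => hf i (Finset.mem_insert_of_mem hi))

lemma linear (L : E →ₗ[ℝ] ℝ) : IsSph 1 (fun u => L u) := by
  intro y e _ _ _
  simpa using (IsTrig.cos.mul (IsTrig.const (L y))).add (IsTrig.sin.mul (IsTrig.const (L e)))

lemma polynomial_comp {G : E → ℝ} (hG : IsSph 1 G) {P : Polynomial ℝ} {N : ℕ}
    (hP : P.natDegree ≤ N) : IsSph N (fun u => P.eval (G u)) := by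
  simp only [Polynomial.eval_eq_sum_range]
  refine sum _ fun i hi => ?_
  have h := (const (E := E) (P.coeff i)).mul (hG.pow i)
  refine h.mono ?_
  have := Finset.mem_range.mp hi
  omega

lemma abs_sub_le {N : ℕ} (hN : 0 < N) {G : E → ℝ} (hG : IsSph N G) {A : ℝ}
    (hA : ∀ u, ‖u‖ = 1 → |G u| ≤ A) {y z : E} (hy : ‖y‖ = 1) (hz : ‖z‖ = 1) :
    |G y - G z| ≤ 16 * N * A * ‖y - z‖ := by
  have hN1 : (1 : ℝ) ≤ N := by exact_mod_cast hN
  have hA0 : 0 ≤ A := (abs_nonneg _).trans (hA y hy)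
  set c : ℝ := inner ℝ y z with hc
  have hdist : ‖y - z‖ ^ 2 = 2 - 2 * c := by
    rw [norm_sub_sq_real, hy, hz]
    ring
  have hcabs : |c| ≤ 1 := by
    simpa [hy, hz] using abs_real_inner_le_norm y z
  obtain ⟨hc1, hc2⟩ := abs_le.mp hcabs
  rcases eq_or_lt_of_le hc2 with h1 | h1
  · have : y = z := (inner_eq_one_iff_of_norm_eq_one hy hz).mp h1
    simp [this]
  rcases eq_or_lt_of_le hc1 with h2 | h2
  · have h3 : ‖y - z‖ = 2 := by
      have : ‖y - z‖ ^ 2 = 2 ^ 2 := by rw [hdist, ← h2]; norm_num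
      exact (pow_left_inj₀ (norm_nonneg _) (by norm_num) two_ne_zero).mp this
    have h4 : |G y - G z| ≤ A + A := (abs_sub _ _).trans (add_le_add (hA y hy) (hA z hz))
    rw [h3]
    nlinarith [mul_le_mul_of_nonneg_right hN1 hA0]
  have hs : 0 < 1 - c ^ 2 := by nlinarith
  set s : ℝ := √(1 - c ^ 2) with hsdef
  have hs0 : 0 < s := Real.sqrt_pos.mpr hs
  have hs2 : s ^ 2 = 1 - c ^ 2 := Real.sq_sqrt hs.le
  set e : E := s⁻¹ • (z - c • y) with he
  have hye : inner ℝ y e = 0 := by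
    rw [he, inner_smul_right, inner_sub_right, inner_smul_right, real_inner_self_eq_norm_sq, hy,
      ← hc]
    ring
  have hne : ‖e‖ = 1 := by
    have h3 : ‖z - c • y‖ ^ 2 = s ^ 2 := by
      rw [norm_sub_sq_real, inner_smul_right, real_inner_comm, ← hc, norm_smul, hy, hz, hs2,
        mul_one, Real.norm_eq_abs, sq_abs]
      ring
    have h4 : ‖z - c • y‖ = s := (pow_left_inj₀ (norm_nonneg _) hs0.le two_ne_zero).mp h3
    rw [he, norm_smul, h4, Real.norm_eq_abs, abs_of_pos (inv_pos.mpr hs0),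
      inv_mul_cancel₀ hs0.ne']
  have hcos : Real.cos (Real.arccos c) = c := Real.cos_arccos hc1 hc2
  have hsin : Real.sin (Real.arccos c) = s := Real.sin_arccos c
  have hze : Real.cos (Real.arccos c) • y + Real.sin (Real.arccos c) • e = z := by
    rw [hcos, hsin, he, smul_inv_smul₀ hs0.ne']
    abel
  have hunit : ∀ θ : ℝ, ‖Real.cos θ • y + Real.sin θ • e‖ = 1 := by
    intro θ
    have h3 : ‖Real.cos θ • y + Real.sin θ • e‖ ^ 2 = 1 ^ 2 := by
      rw [norm_add_sq_real, inner_smul_left, inner_smul_right, hye, norm_smul, norm_smul, hy, hne]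
      simp
    exact (pow_left_inj₀ (norm_nonneg _) zero_le_one two_ne_zero).mp h3
  have hlip := (hG y e hy hne hye).abs_sub_le hN (fun θ => hA _ (hunit θ)) 0 (Real.arccos c)
  simp only [hze, Real.cos_zero, Real.sin_zero, one_smul, zero_smul, add_zero, zero_sub, abs_neg]
    at hlip
  have hα0 := Real.arccos_nonneg c
  have hα : Real.arccos c ≤ Real.pi / 2 * ‖y - z‖ := by
    have h3 := Real.cos_le_one_sub_mul_cos_sq (x := Real.arccos c)
      (by rw [abs_of_nonneg hα0]; exact Real.arccos_le_pi c)
    rw [hcos] at h3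
    have hpi := Real.pi_pos
    refine le_of_sq_le_sq ?_ (by positivity)
    rw [mul_pow, hdist]
    have h4 : 2 / Real.pi ^ 2 * Real.arccos c ^ 2 ≤ 1 - c := by linarith
    rw [div_mul_eq_mul_div, div_le_iff₀ (by positivity)] at h4
    nlinarith
  rw [abs_of_nonneg hα0] at hlip
  have hNA : 0 ≤ (N : ℝ) * A := by positivity
  have hpi : Real.pi ≤ 3.2 := by linarith [Real.pi_lt_d2]
  have h5 : Real.arccos c ≤ 1.6 * ‖y - z‖ :=
    hα.trans (mul_le_mul_of_nonneg_right (by linarith) (norm_nonneg _))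
  nlinarith [mul_le_mul_of_nonneg_left h5 hNA]

end IsSph

/-- A normalized Fejér-type polynomial. -/
lemma exists_fejer_polynomial (n : ℕ) (hn : 0 < n) :
    ∃ K : Polynomial ℝ, K.natDegree ≤ n ∧ K.eval 1 = 1 ∧
      ∀ t : ℝ, |t| ≤ 1 → |K.eval t| ≤ 1 ∧ |K.eval t| * ((n : ℝ) ^ 2 * (1 - t)) ≤ 2 := by
  have hn0 : (0 : ℝ) < (n : ℝ) ^ 2 := by positivity
  set T : Polynomial ℝ := Polynomial.Chebyshev.T ℝ n with hT
  have hroot : (1 - T).IsRoot 1 := by simp [hT]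
  obtain ⟨q, hq⟩ := Polynomial.dvd_iff_isRoot.mpr hroot
  have hT' : T.derivative.eval 1 = (n : ℝ) ^ 2 := by
    rw [hT, Polynomial.Chebyshev.T_derivative_eq_U]
    simp [sq]
  have hq1 : q.eval 1 = -(n : ℝ) ^ 2 := by
    have h := congrArg (fun P => (Polynomial.derivative P).eval 1) hq
    simp only [Polynomial.derivative_sub, Polynomial.derivative_one, Polynomial.eval_sub, hT',
      Polynomial.derivative_mul, Polynomial.derivative_X, Polynomial.derivative_C,
      Polynomial.eval_add, Polynomial.eval_mul, Polynomial.eval_X, Polynomial.eval_C,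
      Polynomial.eval_one, Polynomial.eval_zero, Polynomial.derivative_C] at h
    linarith
  have hbound : ∀ t : ℝ, |t| ≤ 1 → |1 - T.eval t| ≤ (n : ℝ) ^ 2 * (1 - t) := by
    intro t ht
    have hd : ∀ x ∈ Set.Icc (-1 : ℝ) 1, ‖T.derivative.eval x‖ ≤ (n : ℝ) ^ 2 := by
      intro x hx
      have h := Polynomial.Chebyshev.abs_iterate_derivative_T_real_le n 1 (abs_le.mpr hx)
      simp only [Function.iterate_one] at h
      rwa [← hT, hT'] at h
    have h := Convex.norm_image_sub_le_of_norm_hasDerivWithin_le (f := fun x => T.eval x)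
      (fun x _ => (T.hasDerivAt x).hasDerivWithinAt) hd (convex_Icc _ _)
      (abs_le.mp ht) (Set.right_mem_Icc.mpr (by norm_num : (-1 : ℝ) ≤ 1))
    have h1 : T.eval 1 = 1 := by simp [hT]
    rw [h1, Real.norm_eq_abs, Real.norm_eq_abs,
      abs_of_nonneg (by linarith [(abs_le.mp ht).2] : 0 ≤ 1 - t)] at h
    exact h
  have hqe : ∀ t : ℝ, (1 - T.eval t) = (t - 1) * q.eval t := by
    intro t
    have := congrArg (Polynomial.eval t) hq
    simpa using this
  refine ⟨Polynomial.C (-((n : ℝ) ^ 2)⁻¹) * q, ?_, ?_, ?_⟩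
  · refine (Polynomial.natDegree_C_mul_le _ _).trans ?_
    by_cases hq0 : q = 0
    · simp [hq0]
    have h1 : (1 - T).natDegree = 1 + q.natDegree := by
      rw [hq, Polynomial.natDegree_mul (Polynomial.X_sub_C_ne_zero 1) hq0,
        Polynomial.natDegree_X_sub_C]
    have h2 : (1 - T).natDegree ≤ n := by
      refine (Polynomial.natDegree_sub_le 1 T).trans (max_le (by simp) ?_)
      rw [hT, Polynomial.Chebyshev.natDegree_T]
      simp
    omega
  · rw [Polynomial.eval_mul, Polynomial.eval_C, hq1]
    field_simp
  · intro t ht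
    have ht1 : t ≤ 1 := (abs_le.mp ht).2
    rw [Polynomial.eval_mul, Polynomial.eval_C, abs_mul, abs_neg, abs_of_pos (inv_pos.mpr hn0)]
    have h1 : (1 - t) * |q.eval t| = |1 - T.eval t| := by
      rw [hqe, abs_mul, abs_sub_comm, abs_of_nonneg (by linarith : 0 ≤ 1 - t)]
    constructor
    · rw [inv_mul_le_iff₀ hn0, mul_one]
      rcases eq_or_lt_of_le ht1 with h | h
      · rw [h, hq1, abs_neg, abs_of_pos hn0]
      · have h2 := hbound t ht
        rw [← h1, mul_comm ((n : ℝ) ^ 2)] at h2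
        exact le_of_mul_le_mul_left h2 (by linarith)
    · have h2 : ((n : ℝ) ^ 2)⁻¹ * |q.eval t| * ((n : ℝ) ^ 2 * (1 - t)) = |1 - T.eval t| := by
        rw [← h1]
        field_simp
      rw [h2]
      have h3 := Polynomial.Chebyshev.abs_eval_T_real_le_one n ht
      rw [← hT] at h3
      have h4 := abs_le.mp h3
      rw [abs_le]
      constructor <;> linarith [h4.1, h4.2]

lemma IsSph.exists_localized_kernel {E : Type*} [NormedAddCommGroup E] [InnerProductSpace ℝ E]
    (k n : ℕ) (hn : 0 < n) {y : E} (hy : ‖y‖ = 1) :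
    ∃ Q : E → ℝ, IsSph (k * n) Q ∧ Q y = 1 ∧ ∀ u, ‖u‖ = 1 →
      |Q u| ≤ 1 ∧ |Q u| * (1 + n * ‖u - y‖) ^ (2 * k) ≤ 10 ^ k := by
  obtain ⟨K, hKd, hK1, hK⟩ := exists_fejer_polynomial n hn
  refine ⟨fun u => K.eval (innerₛₗ ℝ y u) ^ k,
    ((IsSph.linear (innerₛₗ ℝ y)).polynomial_comp hKd).pow k, ?_, fun u hu => ?_⟩
  · simp [hy, hK1]
  · have hin : |inner ℝ y u| ≤ 1 := by simpa [hy, hu] using abs_real_inner_le_norm y u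
    obtain ⟨h1, h2⟩ := hK _ hin
    have hd : ‖u - y‖ ^ 2 = 2 * (1 - inner ℝ y u) := by
      rw [norm_sub_sq_real, hy, hu, real_inner_comm]
      ring
    simp only [innerₛₗ_apply_apply]
    rw [abs_pow]
    refine ⟨pow_le_one₀ (abs_nonneg _) h1, ?_⟩
    rw [pow_mul, ← mul_pow]
    refine pow_le_pow_left₀ (by positivity) ?_ k
    have h3 : (1 + n * ‖u - y‖) ^ 2 ≤ 2 + 2 * ((n : ℝ) ^ 2 * ‖u - y‖ ^ 2) := by
      nlinarith [sq_nonneg (1 - n * ‖u - y‖)]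
    rw [hd] at h3
    have h4 := mul_le_mul_of_nonneg_left h3 (abs_nonneg (K.eval (inner ℝ y u)))
    nlinarith

/-- A localized Bernstein inequality, in Lipschitz form. -/
lemma IsSph.abs_sub_le_of_localized {E : Type*} [NormedAddCommGroup E] [InnerProductSpace ℝ E]
    (k : ℕ) : ∃ C : ℝ, 1 ≤ C ∧ ∀ n : ℕ, 0 < n → ∀ F : E → ℝ, IsSph (2 * n) F → ∀ y z : E,
      ‖y‖ = 1 → ‖z‖ = 1 → n * ‖y - z‖ ≤ 1 → ∀ A : ℝ, 0 ≤ A →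
      (∀ u, ‖u‖ = 1 → |F u| ≤ A * (1 + n * ‖u - y‖) ^ (2 * k)) →
      |F y - F z| ≤ C * (n * ‖y - z‖) * A := by
  refine ⟨16 * (k + 2) * 10 ^ k + 16 * (k + 1) * 2 ^ (2 * k), ?_, ?_⟩
  · have h1 : (1 : ℝ) ≤ 10 ^ k := one_le_pow₀ (by norm_num)
    have h2 : (0 : ℝ) ≤ 16 * (k + 1) * 2 ^ (2 * k) := by positivity
    have h3 : (0 : ℝ) ≤ k := by positivity
    nlinarith
  intro n hn F hF y z hy hz hyz A hA0 hA
  obtain ⟨Q, hQ, hQy, hQb⟩ := IsSph.exists_localized_kernel k n hn hy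
  have hFQ : ∀ u, ‖u‖ = 1 → |F u * Q u| ≤ A * 10 ^ k := by
    intro u hu
    rw [abs_mul]
    calc |F u| * |Q u| ≤ (A * (1 + n * ‖u - y‖) ^ (2 * k)) * |Q u| :=
          mul_le_mul_of_nonneg_right (hA u hu) (abs_nonneg _)
      _ = A * (|Q u| * (1 + n * ‖u - y‖) ^ (2 * k)) := by ring
      _ ≤ A * 10 ^ k := mul_le_mul_of_nonneg_left (hQb u hu).2 hA0
  have h1 := (hF.mul hQ).abs_sub_le (by omega) hFQ hy hz
  have h2 := (hQ.mono (Nat.mul_le_mul_right n k.le_succ)).abs_sub_le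
    (Nat.mul_pos k.succ_pos hn) (fun u hu => (hQb u hu).1) hy hz
  have h3 : |F z| ≤ A * 2 ^ (2 * k) := by
    refine (hA z hz).trans (mul_le_mul_of_nonneg_left ?_ hA0)
    refine pow_le_pow_left₀ (by positivity) ?_ _
    rw [norm_sub_rev]
    linarith
  rw [hQy] at h2
  have h4 : F y - F z = (F y * Q y - F z * Q z) - F z * (1 - Q z) := by
    rw [hQy]
    ring
  rw [h4]
  refine (abs_sub _ _).trans ?_
  rw [abs_mul (F z)]
  have h5 := mul_le_mul h3 h2 (abs_nonneg _) (by positivity)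
  push_cast at h1 h5
  calc _ ≤ _ := add_le_add h1 h5
    _ = _ := by ring

/-- A measure is doubling on the set `S` if closed balls centred in `S` satisfy the doubling
condition with a uniform constant. -/
def IsDoublingOn {E : Type*} [PseudoMetricSpace E] [MeasurableSpace E] (ν : Measure E)
    (S : Set E) (D : NNReal) : Prop :=
  ∀ v ∈ S, ∀ R : ℝ, 0 < R → ν (Metric.closedBall v (2 * R)) ≤ D * ν (Metric.closedBall v R)

namespace IsDoublingOn

variable {E : Type*} [PseudoMetricSpace E] [MeasurableSpace E] {ν : Measure E} {S : Set E}
  {D : NNReal}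

lemma measure_closedBall_pow_le (h : IsDoublingOn ν S D) {v : E} (hv : v ∈ S) {R : ℝ} (hR : 0 < R)
    (j : ℕ) : ν (Metric.closedBall v (2 ^ j * R)) ≤ (D : ENNReal) ^ j * ν (Metric.closedBall v R) := by
  induction j with
  | zero => simp
  | succ j ih =>
    rw [pow_succ', mul_assoc, pow_succ', mul_assoc]
    exact (h v hv _ (by positivity)).trans (by gcongr)

lemma measure_closedBall_pos (h : IsDoublingOn ν S D) (hS : ν Sᶜ = 0)
    (hb : Bornology.IsBounded S) (hν : ν ≠ 0) {v : E} (hv : v ∈ S) {R : ℝ} (hR : 0 < R) :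
    0 < ν (Metric.closedBall v R) := by
  rw [pos_iff_ne_zero]
  intro h0
  obtain ⟨r, hr⟩ := hb.subset_closedBall v
  obtain ⟨j, hj⟩ := pow_unbounded_of_one_lt (r / R) (one_lt_two (α := ℝ))
  have h1 := h.measure_closedBall_pow_le hv hR j
  rw [h0, mul_zero] at h1
  apply hν
  rw [← Measure.measure_univ_eq_zero, ← Set.union_compl_self S]
  refine measure_union_null (measure_mono_null (hr.trans ?_) (le_antisymm h1 zero_le)) hS
  apply Metric.closedBall_subset_closedBall
  rw [div_lt_iff₀ hR] at hj
  exact hj.le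

/-- A doubling measure integrates rapidly decaying kernels. -/
lemma lintegral_kernel_le [OpensMeasurableSpace E] (h : IsDoublingOn ν S D) {k : ℕ}
    (hk : 2 * D ≤ 4 ^ k) {n : ℕ} (hn : 0 < n) {z : E} (hz : z ∈ S) :
    ∫⁻ v, (ENNReal.ofReal ((1 + n * dist z v) ^ (2 * k)))⁻¹ ∂ν ≤
      2 * 4 ^ k * ν (Metric.closedBall z (1 / n)) := by
  have hn0 : (0 : ℝ) < n := by exact_mod_cast hn
  set f : ℕ → E → ENNReal := fun j =>
    (Metric.closedBall z (2 ^ j * (1 / n))).indicator (fun _ => 4 ^ k * ((4 ^ k)⁻¹) ^ j) with hf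
  have hfm : ∀ j, Measurable (f j) :=
    fun j => measurable_const.indicator Metric.isClosed_closedBall.measurableSet
  have hpt : ∀ v, (ENNReal.ofReal ((1 + n * dist z v) ^ (2 * k)))⁻¹ ≤ ∑' j, f j v := by
    intro v
    set t : ℝ := n * dist z v with ht
    have ht0 : 0 ≤ t := by positivity
    have hex : ∃ j : ℕ, t ≤ 2 ^ j := (pow_unbounded_of_one_lt t one_lt_two).imp fun _ h => h.le
    classical
    set j := Nat.find hex with hj
    have hjt : t ≤ 2 ^ j := Nat.find_spec hex
    refine le_trans ?_ (ENNReal.le_tsum j)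
    have hmem : v ∈ Metric.closedBall z (2 ^ j * (1 / n)) := by
      rw [Metric.mem_closedBall, dist_comm, mul_one_div, le_div_iff₀ hn0, mul_comm]
      exact hjt
    rw [hf]
    simp only [Set.indicator_of_mem hmem]
    have hlow : (2 : ℝ) ^ j ≤ 2 * (1 + t) := by
      rcases Nat.eq_zero_or_pos j with h0 | h0
      · rw [h0]
        norm_num
        linarith
      · have h1 : ¬ t ≤ 2 ^ (j - 1) := Nat.find_min hex (by omega)
        have h2 : (2 : ℝ) ^ j = 2 * 2 ^ (j - 1) := by
          rw [← pow_succ']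
          congr 1
          omega
        rw [h2]
        linarith [not_le.mp h1]
    have hlow2 : (4 : ℝ) ^ (k * j) ≤ 4 ^ k * (1 + t) ^ (2 * k) := by
      calc (4 : ℝ) ^ (k * j) = (2 ^ j) ^ (2 * k) := by
            rw [← pow_mul, show (4 : ℝ) = 2 ^ 2 by norm_num, ← pow_mul]
            congr 1
            ring
        _ ≤ (2 * (1 + t)) ^ (2 * k) := by gcongr
        _ = 4 ^ k * (1 + t) ^ (2 * k) := by
            rw [mul_pow, pow_mul 2 2 k]
            norm_num
    have hlow3 : (4 : ENNReal) ^ (k * j) ≤ 4 ^ k * ENNReal.ofReal ((1 + t) ^ (2 * k)) := by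
      have := ENNReal.ofReal_le_ofReal hlow2
      rwa [ENNReal.ofReal_mul (by positivity), ENNReal.ofReal_pow (by norm_num),
        ENNReal.ofReal_pow (by norm_num : (0 : ℝ) ≤ 4), ENNReal.ofReal_ofNat] at this
    have h40 : (4 : ENNReal) ^ k ≠ 0 := by simp
    have h4t : (4 : ENNReal) ^ k ≠ ⊤ := by simp
    calc (ENNReal.ofReal ((1 + t) ^ (2 * k)))⁻¹
        = 4 ^ k * (4 ^ k * ENNReal.ofReal ((1 + t) ^ (2 * k)))⁻¹ := by
          rw [ENNReal.mul_inv (Or.inl h40) (Or.inl h4t), ← mul_assoc,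
            ENNReal.mul_inv_cancel h40 h4t, one_mul]
      _ ≤ 4 ^ k * (4 ^ (k * j))⁻¹ := by gcongr
      _ = 4 ^ k * ((4 ^ k)⁻¹) ^ j := by rw [pow_mul, ENNReal.inv_pow (n := j)]
  calc ∫⁻ v, (ENNReal.ofReal ((1 + n * dist z v) ^ (2 * k)))⁻¹ ∂ν
      ≤ ∫⁻ v, ∑' j, f j v ∂ν := lintegral_mono hpt
    _ = ∑' j, ∫⁻ v, f j v ∂ν := lintegral_tsum fun j => (hfm j).aemeasurable
    _ ≤ ∑' j, 4 ^ k * ν (Metric.closedBall z (1 / n)) * (2⁻¹) ^ j := by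
        refine ENNReal.tsum_le_tsum fun j => ?_
        rw [hf]
        simp only [lintegral_indicator_const Metric.isClosed_closedBall.measurableSet]
        have h1 := h.measure_closedBall_pow_le hz (by positivity : 0 < 1 / (n : ℝ)) j
        have h2 : ((4 : ENNReal) ^ k)⁻¹ * D ≤ 2⁻¹ := by
          have h3 : (2 : ENNReal) * D ≤ 4 ^ k := by exact_mod_cast hk
          calc ((4 : ENNReal) ^ k)⁻¹ * D = 2⁻¹ * 2 * ((4 ^ k)⁻¹ * D) := by
                rw [ENNReal.inv_mul_cancel (by norm_num) (by norm_num), one_mul]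
            _ = 2⁻¹ * ((4 ^ k)⁻¹ * (2 * D)) := by ring
            _ ≤ 2⁻¹ * ((4 ^ k)⁻¹ * 4 ^ k) := by gcongr
            _ = 2⁻¹ := by
                rw [ENNReal.inv_mul_cancel (by simp) (by simp), mul_one]
        calc 4 ^ k * ((4 ^ k)⁻¹) ^ j * ν (Metric.closedBall z (2 ^ j * (1 / n)))
            ≤ 4 ^ k * ((4 ^ k)⁻¹) ^ j * ((D : ENNReal) ^ j * ν (Metric.closedBall z (1 / n))) := by
              gcongr
          _ = 4 ^ k * ν (Metric.closedBall z (1 / n)) * (((4 : ENNReal) ^ k)⁻¹ * D) ^ j := by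
              rw [mul_pow]; ring
          _ ≤ _ := by gcongr
    _ = 2 * 4 ^ k * ν (Metric.closedBall z (1 / n)) := by
        rw [ENNReal.tsum_mul_left, ENNReal.tsum_geometric, ENNReal.one_sub_inv_two, inv_inv]
        ring

end IsDoublingOn

/-- The part of the Euclidean unit sphere where all coordinates are nonnegative. -/
def octant (ι : Type*) [Fintype ι] : Set (EuclideanSpace ℝ ι) :=
  {v | ‖v‖ = 1 ∧ ∀ i, 0 ≤ v i}

/-- The coordinatewise absolute value. -/
def coordAbs {ι : Type*} (u : EuclideanSpace ℝ ι) : EuclideanSpace ℝ ι :=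
  WithLp.toLp 2 (fun i => |u i|)

section Octant

variable {ι : Type*} [Fintype ι]

lemma norm_coordAbs (u : EuclideanSpace ℝ ι) : ‖coordAbs u‖ = ‖u‖ := by
  simp [EuclideanSpace.norm_eq, coordAbs]

lemma coordAbs_mem_octant {u : EuclideanSpace ℝ ι} (hu : ‖u‖ = 1) : coordAbs u ∈ octant ι :=
  ⟨by rw [norm_coordAbs, hu], fun i => abs_nonneg (u i)⟩

lemma norm_coordAbs_sub_le (u : EuclideanSpace ℝ ι) {v : EuclideanSpace ℝ ι} (hv : v ∈ octant ι) :
    ‖coordAbs u - v‖ ≤ ‖u - v‖ := by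
  rw [EuclideanSpace.norm_eq, EuclideanSpace.norm_eq]
  refine Real.sqrt_le_sqrt (Finset.sum_le_sum fun i _ => ?_)
  simp only [PiLp.sub_apply, coordAbs, Real.norm_eq_abs]
  have h := abs_abs_sub_abs_le (u i) (v i)
  rw [abs_of_nonneg (hv.2 i)] at h
  exact pow_le_pow_left₀ (abs_nonneg _) h 2

lemma isClosed_octant : IsClosed (octant ι) := by
  have h : octant ι = {v | ‖v‖ = 1} ∩ ⋂ i, {v | 0 ≤ v i} := by
    ext v
    simp [octant]
  rw [h]
  exact (isClosed_eq continuous_norm continuous_const).inter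
    (isClosed_iInter fun i => isClosed_le continuous_const (by fun_prop))

lemma isCompact_octant : IsCompact (octant ι) :=
  (isCompact_sphere (0 : EuclideanSpace ℝ ι) 1).of_isClosed_subset isClosed_octant
    fun v hv => by simpa using hv.1

end Octant

/-- The value of a localized maximal function of a polynomial at a point is controlled by the
values of the polynomial in a small cap. -/
lemma IsSph.exists_cap {ι : Type*} [Fintype ι] (k : ℕ) : ∃ δ : ℝ, 0 < δ ∧ δ ≤ 1 ∧
    ∀ n : ℕ, 0 < n → ∀ F : EuclideanSpace ℝ ι → ℝ, IsSph (2 * n) F → Continuous F →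
      (∀ u, F (coordAbs u) = F u) → ∀ v ∈ octant ι, ∃ A : ℝ, 0 ≤ A ∧
        (∀ u, ‖u‖ = 1 → |F u| ≤ A * (1 + n * ‖u - v‖) ^ (2 * k)) ∧
        ∃ u ∈ octant ι, ∀ z ∈ octant ι, dist z u ≤ δ / n →
          A * (1 + n * dist z v) ^ (2 * k) ≤ 2 * 4 ^ k * |F z| := by
  obtain ⟨C, hC1, hC⟩ := IsSph.abs_sub_le_of_localized (E := EuclideanSpace ℝ ι) k
  refine ⟨1 / (2 * C), by positivity, ?_, ?_⟩
  · rw [div_le_one (by positivity)]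
    linarith
  intro n hn F hF hFc hFe v hv
  have hn0 : (0 : ℝ) < n := by exact_mod_cast hn
  have hpos : ∀ u : EuclideanSpace ℝ ι, 0 < (1 + n * ‖u - v‖) ^ (2 * k) := fun u => by positivity
  obtain ⟨u, hu, hmax⟩ := isCompact_octant.exists_isMaxOn ⟨v, hv⟩
    (f := fun u : EuclideanSpace ℝ ι => |F u| / (1 + n * ‖u - v‖) ^ (2 * k))
    (Continuous.continuousOn (by
      refine Continuous.div (by fun_prop) (by fun_prop) fun u => (hpos u).ne'))
  set A : ℝ := |F u| / (1 + n * ‖u - v‖) ^ (2 * k) with hA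
  have hA0 : 0 ≤ A := by positivity
  have hAu : |F u| = A * (1 + n * ‖u - v‖) ^ (2 * k) := by
    rw [hA, div_mul_cancel₀ _ (hpos u).ne']
  have hbd : ∀ z, ‖z‖ = 1 → |F z| ≤ A * (1 + n * ‖z - v‖) ^ (2 * k) := by
    intro z hz
    have h1 := hmax (coordAbs_mem_octant hz)
    simp only [Set.mem_ofPred_eq] at h1
    rw [hFe, div_le_iff₀ (hpos _)] at h1
    refine h1.trans ?_
    have := norm_coordAbs_sub_le z hv
    gcongr
  refine ⟨A, hA0, hbd, u, hu, fun z hz hzu => ?_⟩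
  rw [dist_eq_norm] at hzu ⊢
  have hzu' : n * ‖u - z‖ ≤ 1 / (2 * C) := by
    rw [norm_sub_rev]
    rwa [le_div_iff₀ hn0, mul_comm] at hzu
  have hC2 : 1 / (2 * C) ≤ 1 := by
    rw [div_le_one (by positivity)]
    linarith
  have h2 := hC n hn F hF u z hu.1 hz.1 (hzu'.trans hC2) |F u| (abs_nonneg _) (by
    intro x hx
    refine (hbd x hx).trans ?_
    rw [hAu, mul_assoc, ← mul_pow]
    have h3 : 1 + n * ‖x - v‖ ≤ (1 + n * ‖u - v‖) * (1 + n * ‖x - u‖) := by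
      have h4 : ‖x - v‖ ≤ ‖x - u‖ + ‖u - v‖ := norm_sub_le_norm_sub_add_norm_sub x u v
      nlinarith [mul_nonneg (mul_nonneg hn0.le (norm_nonneg (u - v)))
        (mul_nonneg hn0.le (norm_nonneg (x - u)))]
    gcongr)
  have h3 : C * (n * ‖u - z‖) ≤ 1 / 2 := by
    calc C * (n * ‖u - z‖) ≤ C * (1 / (2 * C)) := by gcongr
      _ = 1 / 2 := by field_simp
  have h4 : |F u| ≤ 2 * |F z| := by
    have h5 := abs_sub_abs_le_abs_sub (F u) (F z)
    nlinarith [mul_le_mul_of_nonneg_right h3 (abs_nonneg (F u))]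
  have h6 : 1 + n * ‖z - v‖ ≤ 2 * (1 + n * ‖u - v‖) := by
    have h7 : ‖z - v‖ ≤ ‖u - z‖ + ‖u - v‖ := by
      rw [norm_sub_rev u z]
      exact norm_sub_le_norm_sub_add_norm_sub z u v
    nlinarith [mul_le_mul_of_nonneg_left h7 hn0.le, mul_nonneg hn0.le (norm_nonneg (u - v))]
  calc A * (1 + n * ‖z - v‖) ^ (2 * k) ≤ A * (2 * (1 + n * ‖u - v‖)) ^ (2 * k) := by gcongr
    _ = 4 ^ k * (A * (1 + n * ‖u - v‖) ^ (2 * k)) := by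
        rw [mul_pow, pow_mul 2 2 k]
        norm_num
        ring
    _ ≤ 4 ^ k * (2 * |F z|) := by
        rw [← hAu]
        gcongr
    _ = 2 * 4 ^ k * |F z| := by ring

/-- A function dominated by the localized maximal function of a polynomial is dominated by a
weighted average of the polynomial. -/
lemma IsDoublingOn.rpow_le_lintegral {ι : Type*} [Fintype ι] {ν : Measure (EuclideanSpace ℝ ι)}
    [IsFiniteMeasure ν] {D : NNReal} (hD : IsDoublingOn ν (octant ι) D)
    (hS : ν (octant ι)ᶜ = 0) (hν : ν ≠ 0) {p : ℝ} (hp : 1 ≤ p) (k : ℕ) :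
    ∃ c : ENNReal, c ≠ ⊤ ∧ ∀ n : ℕ, 0 < n → ∀ F : EuclideanSpace ℝ ι → ℝ,
      IsSph (2 * n) F → Continuous F → (∀ u, F (coordAbs u) = F u) →
      ∀ v ∈ octant ι, ∀ h : ℝ,
        (∀ A : ℝ, 0 ≤ A →
          (∀ u, ‖u‖ = 1 → |F u| ≤ A * (1 + n * ‖u - v‖) ^ (2 * k)) → h ≤ A) →
        ENNReal.ofReal h ^ p ≤ c * ∫⁻ z, ENNReal.ofReal |F z| ^ p *
          (ENNReal.ofReal ((1 + n * dist z v) ^ (2 * k)))⁻¹ *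
          (ν (Metric.closedBall z (1 / n)))⁻¹ ∂ν := by
  have hp0 : 0 ≤ p := by linarith
  have hS' : ∀ᵐ v ∂ν, v ∈ octant ι := by
    rw [ae_iff]
    exact hS
  obtain ⟨δ, hδ0, hδ1, hδ⟩ := IsSph.exists_cap (ι := ι) k
  obtain ⟨j, hj⟩ : ∃ j : ℕ, 2 / δ < 2 ^ j := pow_unbounded_of_one_lt (2 / δ) one_lt_two
  set a : ENNReal := ENNReal.ofReal (2 * 4 ^ k) ^ p with ha
  refine ⟨a * D ^ j, ENNReal.mul_ne_top (ENNReal.rpow_ne_top_of_nonneg hp0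
      ENNReal.ofReal_ne_top) (ENNReal.pow_ne_top ENNReal.coe_ne_top), ?_⟩
  intro n hn F hF hFc hFe v hv h hH
  have hn0 : (0 : ℝ) < n := by exact_mod_cast hn
  set W : EuclideanSpace ℝ ι → ENNReal := fun z => ν (Metric.closedBall z (1 / n)) with hW
  have hWpos : ∀ z ∈ octant ι, 0 < W z := fun z hz =>
    hD.measure_closedBall_pos hS isCompact_octant.isBounded hν hz (by positivity)
  set κ : EuclideanSpace ℝ ι → EuclideanSpace ℝ ι → ENNReal :=
    fun z v => (ENNReal.ofReal ((1 + n * dist z v) ^ (2 * k)))⁻¹ with hκ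
  obtain ⟨A, hA0, hA, u, hu, hcap⟩ := hδ n hn F hF hFc hFe v hv
  have hHA : ENNReal.ofReal (h) ^ p ≤ ENNReal.ofReal A ^ p := by
    gcongr
    exact hH A hA0 hA
  set B : Set (EuclideanSpace ℝ ι) := Metric.closedBall u (δ / n) with hB
  have hBpos : ν B ≠ 0 := (hD.measure_closedBall_pos hS isCompact_octant.isBounded hν hu
    (by positivity)).ne'
  have hBtop : ν B ≠ ⊤ := measure_ne_top ν B
  have hWB : ∀ z ∈ B, W z ≤ D ^ j * ν B := by
    intro z hz
    refine (measure_mono ?_).trans (hD.measure_closedBall_pow_le hu (by positivity) j)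
    refine Metric.closedBall_subset_closedBall' ?_
    have h1 : dist z u ≤ 1 / n := (Metric.mem_closedBall.mp hz).trans (by gcongr)
    rw [div_lt_iff₀ hδ0] at hj
    rw [mul_div_assoc', le_div_iff₀ hn0]
    rw [le_div_iff₀ hn0] at h1
    rw [add_mul, one_div, inv_mul_cancel₀ hn0.ne']
    linarith
  have hval : ∀ z ∈ B, z ∈ octant ι → ENNReal.ofReal A ^ p ≤
      a * (ENNReal.ofReal |F z| ^ p * κ z v) := by
    intro z hz hzo
    have h1 := hcap z hzo hz
    set b : ℝ := (1 + n * dist z v) ^ (2 * k) with hb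
    have hb1 : 1 ≤ b := one_le_pow₀ (by linarith [mul_nonneg hn0.le (dist_nonneg (x := z) (y := v))])
    have h2 := ENNReal.ofReal_le_ofReal h1
    rw [ENNReal.ofReal_mul hA0, ENNReal.ofReal_mul (by positivity)] at h2
    have hb0 : ENNReal.ofReal b ≠ 0 := by
      rw [Ne, ENNReal.ofReal_eq_zero]
      linarith
    have h3 : ENNReal.ofReal A ≤ ENNReal.ofReal (2 * 4 ^ k) * ENNReal.ofReal |F z| * κ z v := by
      calc ENNReal.ofReal A = ENNReal.ofReal A * ENNReal.ofReal b * κ z v := by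
            rw [mul_assoc, ENNReal.mul_inv_cancel hb0 ENNReal.ofReal_ne_top, mul_one]
        _ ≤ _ := by gcongr
    have h4 : κ z v ^ p ≤ κ z v := by
      refine ENNReal.rpow_le_self_of_le_one ?_ hp
      rw [hκ]
      simp only
      rw [ENNReal.inv_le_one, ← ENNReal.ofReal_one]
      exact ENNReal.ofReal_le_ofReal hb1
    calc ENNReal.ofReal A ^ p
        ≤ (ENNReal.ofReal (2 * 4 ^ k) * ENNReal.ofReal |F z| * κ z v) ^ p := by gcongr
      _ = a * (ENNReal.ofReal |F z| ^ p * κ z v ^ p) := by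
          rw [ENNReal.mul_rpow_of_nonneg _ _ hp0, ENNReal.mul_rpow_of_nonneg _ _ hp0, mul_assoc]
      _ ≤ _ := by gcongr
  calc ENNReal.ofReal (h) ^ p ≤ ENNReal.ofReal A ^ p := hHA
    _ = ∫⁻ z in B, ENNReal.ofReal A ^ p * (ν B)⁻¹ ∂ν := by
        rw [setLIntegral_const, mul_assoc, ENNReal.inv_mul_cancel hBpos hBtop, mul_one]
    _ ≤ ∫⁻ z in B, a * D ^ j * (ENNReal.ofReal |F z| ^ p * κ z v * (W z)⁻¹) ∂ν := by
        refine lintegral_mono_ae ?_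
        rw [ae_restrict_iff' Metric.isClosed_closedBall.measurableSet]
        filter_upwards [hS'] with z hzo hz
        have h1 : (ν B)⁻¹ ≤ D ^ j * (W z)⁻¹ := by
          calc (ν B)⁻¹ = (ν B)⁻¹ * (W z * (W z)⁻¹) := by
                rw [ENNReal.mul_inv_cancel (hWpos z hzo).ne' (measure_ne_top _ _), mul_one]
            _ ≤ (ν B)⁻¹ * (D ^ j * ν B * (W z)⁻¹) := by
                gcongr
                exact hWB z hz
            _ = D ^ j * (W z)⁻¹ * ((ν B)⁻¹ * ν B) := by ring
            _ = D ^ j * (W z)⁻¹ := by rw [ENNReal.inv_mul_cancel hBpos hBtop, mul_one]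
        calc ENNReal.ofReal A ^ p * (ν B)⁻¹
            ≤ a * (ENNReal.ofReal |F z| ^ p * κ z v) * (D ^ j * (W z)⁻¹) :=
              mul_le_mul' (hval z hz hzo) h1
          _ = _ := by ring
    _ ≤ ∫⁻ z, a * D ^ j * (ENNReal.ofReal |F z| ^ p * κ z v * (W z)⁻¹) ∂ν :=
        setLIntegral_le_lintegral _ _
    _ = _ := lintegral_const_mul' _ _ (ENNReal.mul_ne_top
        (ENNReal.rpow_ne_top_of_nonneg hp0 ENNReal.ofReal_ne_top)
        (ENNReal.pow_ne_top ENNReal.coe_ne_top))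

lemma ENNReal.mul_inv_mul_le {x y w b : ENNReal} (hw : w ≠ 0) (hw' : w ≠ ⊤) (h : y ≤ b * w) :
    x * w⁻¹ * y ≤ b * x := by
  calc x * w⁻¹ * y ≤ x * w⁻¹ * (b * w) := by gcongr
    _ = b * x * (w⁻¹ * w) := by ring
    _ = b * x := by rw [ENNReal.inv_mul_cancel hw hw', mul_one]

lemma lintegral_lintegral_weighted_le {E : Type*} [MeasurableSpace E] {ν : Measure E} [SFinite ν]
    {g W : E → ENNReal} {κ : E → E → ENNReal} (hg : Measurable g) (hW : Measurable W)
    (hκ : Measurable (Function.uncurry κ)) {b : ENNReal}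
    (h : ∀ᵐ z ∂ν, W z ≠ 0 ∧ W z ≠ ⊤ ∧ ∫⁻ v, κ z v ∂ν ≤ b * W z) :
    ∫⁻ v, ∫⁻ z, g z * κ z v * (W z)⁻¹ ∂ν ∂ν ≤ b * ∫⁻ z, g z ∂ν := by
  rw [lintegral_lintegral_swap, ← lintegral_const_mul _ hg]
  · refine lintegral_mono_ae ?_
    filter_upwards [h] with z hz
    have h2 : ∫⁻ v, g z * κ z v * (W z)⁻¹ ∂ν = g z * (W z)⁻¹ * ∫⁻ v, κ z v ∂ν := by
      have h3 : Measurable (κ z) := hκ.of_uncurry_left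
      rw [← lintegral_const_mul _ h3]
      exact lintegral_congr fun v => mul_right_comm _ _ _
    rw [h2]
    exact ENNReal.mul_inv_mul_le hz.1 hz.2.1 hz.2.2
  · refine (Measurable.mul (Measurable.mul ?_ ?_) ?_).aemeasurable
    · exact hg.comp measurable_snd
    · exact hκ.comp measurable_swap
    · exact (hW.comp measurable_snd).inv

/-- A function dominated by the localized maximal function of a polynomial is bounded in weighted
`L^p` by the polynomial. -/
theorem IsDoublingOn.lintegral_rpow_le {ι : Type*} [Fintype ι] {ν : Measure (EuclideanSpace ℝ ι)}
    [IsFiniteMeasure ν] {D : NNReal} (hD : IsDoublingOn ν (octant ι) D)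
    (hS : ν (octant ι)ᶜ = 0) {p : ℝ} (hp : 1 ≤ p) :
    ∃ k : ℕ, ∃ c : ENNReal, c ≠ ⊤ ∧ ∀ n : ℕ, 0 < n → ∀ F : EuclideanSpace ℝ ι → ℝ,
      IsSph (2 * n) F → Continuous F → (∀ u, F (coordAbs u) = F u) →
      ∀ H : EuclideanSpace ℝ ι → ℝ,
        (∀ v ∈ octant ι, ∀ A : ℝ, 0 ≤ A →
          (∀ u, ‖u‖ = 1 → |F u| ≤ A * (1 + n * ‖u - v‖) ^ (2 * k)) → H v ≤ A) →
        ∫⁻ v, ENNReal.ofReal (H v) ^ p ∂ν ≤ c * ∫⁻ v, ENNReal.ofReal |F v| ^ p ∂ν := by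
  rcases eq_or_ne ν 0 with hν | hν
  · exact ⟨0, 0, by simp, by simp [hν]⟩
  have hS' : ∀ᵐ v ∂ν, v ∈ octant ι := by
    rw [ae_iff]
    exact hS
  obtain ⟨k, hk⟩ : ∃ k : ℕ, 2 * D < 4 ^ k := pow_unbounded_of_one_lt (2 * D) (by norm_num)
  obtain ⟨c, hc, hpt⟩ := hD.rpow_le_lintegral hS hν hp k
  refine ⟨k, c * (2 * 4 ^ k),
    ENNReal.mul_ne_top hc (ENNReal.mul_ne_top (by simp) (by simp)), ?_⟩
  intro n hn F hF hFc hFe H hH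
  have hn0 : (0 : ℝ) < n := by exact_mod_cast hn
  set W : EuclideanSpace ℝ ι → ENNReal := fun z => ν (Metric.closedBall z (1 / n)) with hW
  have hWpos : ∀ z ∈ octant ι, 0 < W z := fun z hz =>
    hD.measure_closedBall_pos hS isCompact_octant.isBounded hν hz (by positivity)
  have hWm : Measurable W := by
    have h1 : MeasurableSet {q : EuclideanSpace ℝ ι × EuclideanSpace ℝ ι |
        dist q.2 q.1 ≤ 1 / (n : ℝ)} :=
      (isClosed_le (by fun_prop) continuous_const).measurableSet
    exact measurable_measure_prodMk_left h1
  set κ : EuclideanSpace ℝ ι → EuclideanSpace ℝ ι → ENNReal :=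
    fun z v => (ENNReal.ofReal ((1 + n * dist z v) ^ (2 * k)))⁻¹ with hκ
  have hFm : Measurable F := hFc.measurable
  have hκm : Measurable (Function.uncurry κ) := by
    have : Continuous (fun q : EuclideanSpace ℝ ι × EuclideanSpace ℝ ι =>
      ((1 + n * dist q.1 q.2) ^ (2 * k) : ℝ)) := by fun_prop
    exact (ENNReal.measurable_ofReal.comp this.measurable).inv
  calc ∫⁻ v, ENNReal.ofReal (H v) ^ p ∂ν
      ≤ ∫⁻ v, c * ∫⁻ z, ENNReal.ofReal |F z| ^ p * κ z v * (W z)⁻¹ ∂ν ∂ν := by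
        refine lintegral_mono_ae ?_
        filter_upwards [hS'] with v hv using hpt n hn F hF hFc hFe v hv (H v) (hH v hv)
    _ = c * ∫⁻ v, ∫⁻ z, ENNReal.ofReal |F z| ^ p * κ z v * (W z)⁻¹ ∂ν ∂ν :=
        lintegral_const_mul' _ _ hc
    _ ≤ c * (2 * 4 ^ k * ∫⁻ z, ENNReal.ofReal |F z| ^ p ∂ν) := by
        refine mul_le_mul_right (lintegral_lintegral_weighted_le
          (hFm.abs.ennreal_ofReal.pow_const p) hWm hκm ?_) c
        filter_upwards [hS'] with z hz using
          ⟨(hWpos z hz).ne', measure_ne_top _ _, hD.lintegral_kernel_le hk.le hn hz⟩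
    _ = _ := (mul_assoc _ _ _).symm

section WeightedDoubling

variable {E : Type*} [PseudoMetricSpace E] [MeasurableSpace E] [OpensMeasurableSpace E]
  {ν : Measure E} {m : E → ℝ} {s : ℝ}

lemma withDensity_rpow_closedBall_le (hs : 0 ≤ s) {v : E} {R a : ℝ}
    (h : ∀ x ∈ Metric.closedBall v R, m x ≤ a) :
    ν.withDensity (fun x => ENNReal.ofReal (m x) ^ s) (Metric.closedBall v R) ≤
      ENNReal.ofReal a ^ s * ν (Metric.closedBall v R) := by
  rw [withDensity_apply _ Metric.isClosed_closedBall.measurableSet, ← setLIntegral_const]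
  refine setLIntegral_mono' Metric.isClosed_closedBall.measurableSet fun x hx => ?_
  exact ENNReal.rpow_le_rpow (ENNReal.ofReal_le_ofReal (h x hx)) hs

lemma le_withDensity_rpow_closedBall (hs : 0 ≤ s) {v : E} {R a : ℝ}
    (h : ∀ x ∈ Metric.closedBall v R, a ≤ m x) :
    ENNReal.ofReal a ^ s * ν (Metric.closedBall v R) ≤
      ν.withDensity (fun x => ENNReal.ofReal (m x) ^ s) (Metric.closedBall v R) := by
  rw [withDensity_apply _ Metric.isClosed_closedBall.measurableSet, ← setLIntegral_const]
  refine setLIntegral_mono' Metric.isClosed_closedBall.measurableSet fun x hx => ?_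
  exact ENNReal.rpow_le_rpow (ENNReal.ofReal_le_ofReal (h x hx)) hs

/-- Multiplying a doubling measure by a power of a Lipschitz function which is large somewhere in
every ball preserves the doubling property. -/
theorem IsDoublingOn.withDensity_rpow {S : Set E} {D : NNReal} (hD : IsDoublingOn ν S D)
    (hS : ν Sᶜ = 0) (hb : ∀ v ∈ S, S ⊆ Metric.closedBall v 2) (hs : 0 ≤ s)
    (hm : ∀ x y, m x ≤ m y + dist x y)
    (hlarge : ∀ v ∈ S, ∀ R, 0 < R → R ≤ 2 → ∃ v' ∈ S, dist v' v ≤ R / 2 ∧ R / 12 ≤ m v') :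
    ∃ D' : NNReal, IsDoublingOn (ν.withDensity fun x => ENNReal.ofReal (m x) ^ s) S D' := by
  set μ := ν.withDensity fun x => ENNReal.ofReal (m x) ^ s with hμ
  have hμS : μ Sᶜ = 0 := withDensity_absolutelyContinuous _ _ hS
  refine ⟨1 + (144 : NNReal) ^ s * (D + D ^ 7), fun v hv R hR => ?_⟩
  have hcast : (((1 + (144 : NNReal) ^ s * (D + D ^ 7) : NNReal)) : ENNReal) =
      1 + (144 : ENNReal) ^ s * (D + D ^ 7) := by
    push_cast
    rw [ENNReal.coe_rpow_of_nonneg _ hs]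
    norm_num
  rw [hcast]
  rcases lt_or_ge 2 R with hR2 | hR2
  · calc μ (Metric.closedBall v (2 * R)) ≤ μ Set.univ := measure_mono (Set.subset_univ _)
      _ = μ (S ∪ Sᶜ) := by rw [Set.union_compl_self]
      _ ≤ μ S + μ Sᶜ := measure_union_le _ _
      _ = μ S := by rw [hμS, add_zero]
      _ ≤ μ (Metric.closedBall v R) :=
        measure_mono ((hb v hv).trans (Metric.closedBall_subset_closedBall hR2.le))
      _ = 1 * μ (Metric.closedBall v R) := (one_mul _).symm
      _ ≤ _ := mul_le_mul_left le_self_add _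
  rcases le_or_gt (4 * R) (m v) with hmv | hmv
  · have h1 : μ (Metric.closedBall v (2 * R)) ≤
        ENNReal.ofReal (144 * (3 / 4 * m v)) ^ s * ν (Metric.closedBall v (2 * R)) := by
      refine withDensity_rpow_closedBall_le hs fun x hx => ?_
      have := hm x v
      rw [Metric.mem_closedBall] at hx
      linarith
    have h2 : ENNReal.ofReal (3 / 4 * m v) ^ s * ν (Metric.closedBall v R) ≤
        μ (Metric.closedBall v R) := by
      refine le_withDensity_rpow_closedBall hs fun x hx => ?_
      have := hm v x
      rw [Metric.mem_closedBall, dist_comm] at hx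
      linarith
    rw [ENNReal.ofReal_mul (by norm_num), ENNReal.mul_rpow_of_nonneg _ _ hs,
      ENNReal.ofReal_ofNat] at h1
    calc μ (Metric.closedBall v (2 * R))
        ≤ 144 ^ s * ENNReal.ofReal (3 / 4 * m v) ^ s * (D * ν (Metric.closedBall v R)) :=
          h1.trans (mul_le_mul_right (hD v hv R hR) _)
      _ = 144 ^ s * D * (ENNReal.ofReal (3 / 4 * m v) ^ s * ν (Metric.closedBall v R)) := by ring
      _ ≤ 144 ^ s * D * μ (Metric.closedBall v R) := mul_le_mul_right h2 _
      _ ≤ _ := by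
        refine mul_le_mul_left ?_ _
        rw [mul_add]
        exact le_self_add.trans le_add_self
  · obtain ⟨v', hv', hd, hmv'⟩ := hlarge v hv R hR hR2
    have h1 : μ (Metric.closedBall v (2 * R)) ≤
        ENNReal.ofReal (144 * (R / 24)) ^ s * ν (Metric.closedBall v (2 * R)) := by
      refine withDensity_rpow_closedBall_le hs fun x hx => ?_
      have := hm x v
      rw [Metric.mem_closedBall] at hx
      linarith
    have h2 : ENNReal.ofReal (R / 24) ^ s * ν (Metric.closedBall v' (R / 24)) ≤
        μ (Metric.closedBall v' (R / 24)) := by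
      refine le_withDensity_rpow_closedBall hs fun x hx => ?_
      have := hm v' x
      rw [Metric.mem_closedBall, dist_comm] at hx
      linarith
    have h3 : ν (Metric.closedBall v (2 * R)) ≤ D ^ 7 * ν (Metric.closedBall v' (R / 24)) := by
      refine (measure_mono ?_).trans (hD.measure_closedBall_pow_le hv' (by positivity) 7)
      refine Metric.closedBall_subset_closedBall' ?_
      rw [dist_comm]
      linarith
    rw [ENNReal.ofReal_mul (by norm_num), ENNReal.mul_rpow_of_nonneg _ _ hs,
      ENNReal.ofReal_ofNat] at h1
    calc μ (Metric.closedBall v (2 * R))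
        ≤ 144 ^ s * ENNReal.ofReal (R / 24) ^ s * (D ^ 7 * ν (Metric.closedBall v' (R / 24))) :=
          h1.trans (mul_le_mul_right h3 _)
      _ = 144 ^ s * D ^ 7 *
          (ENNReal.ofReal (R / 24) ^ s * ν (Metric.closedBall v' (R / 24))) := by ring
      _ ≤ 144 ^ s * D ^ 7 * μ (Metric.closedBall v' (R / 24)) := mul_le_mul_right h2 _
      _ ≤ 144 ^ s * D ^ 7 * μ (Metric.closedBall v R) := by
        refine mul_le_mul_right (measure_mono (Metric.closedBall_subset_closedBall' ?_)) _
        linarith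
      _ ≤ _ := by
        refine mul_le_mul_left ?_ _
        rw [mul_add]
        exact le_add_self.trans le_add_self

end WeightedDoubling

section MinCoord

variable {ι : Type*}

/-- The smaller of two coordinates, in absolute value. -/
def minCoord (i j : ι) (v : EuclideanSpace ℝ ι) : ℝ := min |v i| |v j|

lemma continuous_minCoord (i j : ι) : Continuous (minCoord i j) := by
  unfold minCoord
  fun_prop

variable [Fintype ι]

lemma minCoord_le_add_dist (i j : ι) (x y : EuclideanSpace ℝ ι) :
    minCoord i j x ≤ minCoord i j y + dist x y := by
  have h : ∀ k, |x k| ≤ |y k| + dist x y := fun k => by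
    have h1 := PiLp.norm_apply_le (x - y) k
    rw [PiLp.sub_apply, Real.norm_eq_abs, ← dist_eq_norm] at h1
    linarith [abs_sub_abs_le_abs_sub (x k) (y k)]
  unfold minCoord
  rcases min_choice |y i| |y j| with hc | hc <;> rw [hc]
  · exact (min_le_left _ _).trans (h i)
  · exact (min_le_right _ _).trans (h j)

lemma exists_minCoord_ge [DecidableEq ι] (i j : ι) {v : EuclideanSpace ℝ ι} (hv : v ∈ octant ι)
    {R : ℝ} (hR : 0 < R) (hR2 : R ≤ 2) :
    ∃ v' ∈ octant ι, dist v' v ≤ R / 2 ∧ R / 12 ≤ minCoord i j v' := by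
  set e : EuclideanSpace ℝ ι := EuclideanSpace.single i 1 + EuclideanSpace.single j 1 with he
  have he0 : ∀ k, 0 ≤ e k := fun k => by
    simp only [he, PiLp.add_apply, PiLp.single_apply]
    split_ifs <;> norm_num
  have hei : 1 ≤ e i := by
    simp only [he, PiLp.add_apply, PiLp.single_apply]
    split_ifs <;> norm_num
  have hej : 1 ≤ e j := by
    simp only [he, PiLp.add_apply, PiLp.single_apply]
    split_ifs <;> norm_num
  have hen : ‖e‖ ≤ 2 := (norm_add_le _ _).trans (by simp; norm_num)
  set u := v + (R / 8) • e with hu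
  have huc : ∀ k, u k = v k + R / 8 * e k := fun k => rfl
  have hu1 : 1 ≤ ‖u‖ := by
    rw [← hv.1, EuclideanSpace.norm_eq, EuclideanSpace.norm_eq]
    refine Real.sqrt_le_sqrt (Finset.sum_le_sum fun k _ => ?_)
    rw [huc, Real.norm_eq_abs, Real.norm_eq_abs, abs_of_nonneg (hv.2 k), abs_of_nonneg]
    · have := hv.2 k
      have := he0 k
      gcongr
      nlinarith
    · have := hv.2 k
      have := he0 k
      positivity
  have hue : ‖(R / 8) • e‖ ≤ R / 4 := by
    rw [norm_smul, Real.norm_of_nonneg (by positivity)]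
    nlinarith
  have hu2 : ‖u‖ ≤ 1 + R / 4 := by
    rw [← hv.1]
    exact (norm_add_le _ _).trans (by gcongr)
  have hu0 : 0 < ‖u‖ := by linarith
  refine ⟨‖u‖⁻¹ • u, ⟨?_, fun k => ?_⟩, ?_, ?_⟩
  · rw [norm_smul, norm_inv, norm_norm, inv_mul_cancel₀ hu0.ne']
  · have := hv.2 k
    have := he0 k
    rw [PiLp.smul_apply, smul_eq_mul, huc]
    positivity
  · have h1 : ‖‖u‖⁻¹ • u - u‖ ≤ R / 4 := by
      have h2 : ‖u‖⁻¹ • u - u = (‖u‖⁻¹ - 1) • u := by rw [sub_smul, one_smul]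
      rw [h2, norm_smul, Real.norm_eq_abs, abs_sub_comm, abs_of_nonneg, sub_mul,
        inv_mul_cancel₀ hu0.ne']
      · linarith
      · linarith [inv_le_one_of_one_le₀ hu1]
    have h3 : ‖u - v‖ ≤ R / 4 := by rwa [hu, add_sub_cancel_left]
    rw [dist_eq_norm]
    linarith [norm_sub_le_norm_sub_add_norm_sub (‖u‖⁻¹ • u) u v]
  · have h : ∀ k, 1 ≤ e k → R / 12 ≤ |(‖u‖⁻¹ • u) k| := fun k hk => by
      have h1 : R / 8 ≤ u k := by
        rw [huc]
        nlinarith [hv.2 k]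
      rw [PiLp.smul_apply, smul_eq_mul]
      refine le_trans ?_ (le_abs_self _)
      rw [inv_mul_eq_div, le_div_iff₀ hu0]
      nlinarith
    exact le_min (h i hei) (h j hej)

theorem IsDoublingOn.withDensity_minCoord {ν : Measure (EuclideanSpace ℝ ι)} {D : NNReal}
    (hD : IsDoublingOn ν (octant ι) D) (hS : ν (octant ι)ᶜ = 0) {s : ℝ} (hs : 0 ≤ s) (i j : ι) :
    ∃ D' : NNReal, IsDoublingOn
      (ν.withDensity fun v => ENNReal.ofReal (minCoord i j v) ^ s) (octant ι) D' := by
  classical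
  refine hD.withDensity_rpow hS (fun v hv u hu => ?_) hs (minCoord_le_add_dist i j)
    fun v hv R hR hR2 => exists_minCoord_ge i j hv hR hR2
  rw [Metric.mem_closedBall, dist_eq_norm]
  linarith [norm_sub_le u v, hu.1, hv.1]

end MinCoord

section PolynomialDerivative

open MvPolynomial

lemma MvPolynomial.totalDegree_pderiv_le {σ R : Type*} [CommSemiring R] (i : σ)
    (g : MvPolynomial σ R) : (pderiv i g).totalDegree ≤ g.totalDegree := by
  classical
  refine Finset.sup_le fun m hm => ?_
  rw [mem_support_iff, coeff_pderiv] at hm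
  have h1 : m + Finsupp.single i 1 ∈ g.support := by
    rw [mem_support_iff]
    exact left_ne_zero_of_mul hm
  refine le_trans ?_ (le_totalDegree h1)
  rw [Finsupp.sum_add_index' (fun _ => rfl) (fun _ _ _ => rfl)]
  exact Nat.le_add_right _ _

lemma MvPolynomial.hasFDerivAt_eval {σ : Type*} [Fintype σ] (g : MvPolynomial σ ℝ) (x : σ → ℝ) :
    HasFDerivAt (fun y => eval y g)
      (∑ k, eval x (pderiv k g) • ContinuousLinearMap.proj (R := ℝ) (φ := fun _ => ℝ) k) x := by
  classical
  induction g using MvPolynomial.induction_on with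
  | C a => simpa using hasFDerivAt_const a x
  | add f g hf hg =>
    simp only [map_add, add_smul, Finset.sum_add_distrib]
    exact hf.add hg
  | mul_X f i hf =>
    have h := hf.mul (hasFDerivAt_apply (𝕜 := ℝ) i x)
    simp only [map_mul, eval_X]
    refine h.congr_fderiv ?_
    ext v
    have h1 : ∑ k, eval x f * eval x (Pi.single (M := fun _ => MvPolynomial σ ℝ) k 1 i) * v k =
        eval x f * v i := by
      rw [Finset.sum_eq_single i (fun k _ hk => by simp [hk.symm]) (by simp)]
      simp
    simp only [pderiv_mul, pderiv_X, map_add, map_mul, eval_X, add_smul, Finset.sum_add_distrib,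
      add_apply, FunLike.coe_smul, FunLike.coe_sum, Pi.smul_apply,
      Finset.sum_apply, ContinuousLinearMap.proj_apply, smul_eq_mul, h1, Finset.mul_sum]
    rw [add_comm]
    congr 1
    exact Finset.sum_congr rfl fun k _ => by ring

lemma pd_eval {d : ℕ} (i : Fin d) (g : MvPolynomial (Fin d) ℝ) :
    pd i (fun y => eval y g) = fun y => eval y (pderiv i g) := by
  funext x
  rw [pd, (g.hasFDerivAt_eval x).fderiv]
  simp [Pi.single_apply]

end PolynomialDerivative

section SphericalBernstein

variable {d : ℕ}

/-- The polynomial on the sphere obtained from `g` by squaring the coordinates. -/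
def sqLift (g : MvPolynomial (Fin d) ℝ) (u : EuclideanSpace ℝ (Fin (d + 1))) : ℝ :=
  MvPolynomial.eval (fun i : Fin d => u i.castSucc ^ 2) g

lemma continuous_sqLift (g : MvPolynomial (Fin d) ℝ) : Continuous (sqLift g) :=
  (MvPolynomial.continuous_eval g).comp (by fun_prop)

lemma sqLift_coordAbs (g : MvPolynomial (Fin d) ℝ) (u : EuclideanSpace ℝ (Fin (d + 1))) :
    sqLift g (coordAbs u) = sqLift g u := by
  simp [sqLift, coordAbs]

lemma isSph_sqLift {g : MvPolynomial (Fin d) ℝ} {n : ℕ} (hg : g.totalDegree ≤ n) :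
    IsSph (2 * n) (sqLift g) := by
  have h : sqLift g = fun u : EuclideanSpace ℝ (Fin (d + 1)) =>
      ∑ m ∈ g.support, g.coeff m * ∏ i, (u i.castSucc ^ 2) ^ m i := by
    funext u
    rw [sqLift, MvPolynomial.eval_eq']
  rw [h]
  refine IsSph.sum _ fun m hm => ?_
  have hcoord : ∀ i : Fin d, IsSph (m i * (2 * 1))
      fun u : EuclideanSpace ℝ (Fin (d + 1)) => (u i.castSucc ^ 2) ^ m i := fun i =>
    ((IsSph.linear (EuclideanSpace.proj (𝕜 := ℝ) i.castSucc).toLinearMap).pow 2).pow (m i)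
  refine ((IsSph.const (g.coeff m)).mul (IsSph.prod Finset.univ fun i _ => hcoord i)).mono ?_
  have h1 := (MvPolynomial.le_totalDegree hm).trans hg
  rw [Finsupp.sum_fintype _ _ (fun _ => rfl)] at h1
  rw [← Finset.sum_mul]
  omega

/-- The partial derivative in the `k`-th coordinate, where the last coordinate is regarded as
a function which no polynomial depends on. -/
def extPderiv (k : Fin (d + 1)) (g : MvPolynomial (Fin d) ℝ) : MvPolynomial (Fin d) ℝ :=
  Fin.lastCases (motive := fun _ => MvPolynomial (Fin d) ℝ) 0
    (fun i => MvPolynomial.pderiv i g) k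

@[simp] lemma extPderiv_last (g : MvPolynomial (Fin d) ℝ) : extPderiv (Fin.last d) g = 0 := by
  simp [extPderiv]

@[simp] lemma extPderiv_castSucc (i : Fin d) (g : MvPolynomial (Fin d) ℝ) :
    extPderiv i.castSucc g = MvPolynomial.pderiv i g := by
  simp [extPderiv]

lemma totalDegree_extPderiv_le (k : Fin (d + 1)) (g : MvPolynomial (Fin d) ℝ) :
    (extPderiv k g).totalDegree ≤ g.totalDegree := by
  induction k using Fin.lastCases with
  | last => simp
  | cast i => simpa using g.totalDegree_pderiv_le i

/-- The derivative along the edge of the simplex joining the `i`-th and `j`-th vertices. -/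
def edgeDeriv (i j : Fin (d + 1)) (g : MvPolynomial (Fin d) ℝ) : MvPolynomial (Fin d) ℝ :=
  extPderiv i g - extPderiv j g

lemma totalDegree_edgeDeriv_le (i j : Fin (d + 1)) (g : MvPolynomial (Fin d) ℝ) :
    (edgeDeriv i j g).totalDegree ≤ g.totalDegree :=
  (MvPolynomial.totalDegree_sub _ _).trans
    (max_le (totalDegree_extPderiv_le i g) (totalDegree_extPderiv_le j g))

lemma totalDegree_iterate_edgeDeriv_le (i j : Fin (d + 1)) (g : MvPolynomial (Fin d) ℝ) (r : ℕ) :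
    ((edgeDeriv i j)^[r] g).totalDegree ≤ g.totalDegree := by
  induction r with
  | zero => exact le_rfl
  | succ r ih =>
    rw [Function.iterate_succ_apply']
    exact (totalDegree_edgeDeriv_le i j _).trans ih

lemma hasDerivAt_sqLift (g : MvPolynomial (Fin d) ℝ) {γ : ℝ → EuclideanSpace ℝ (Fin (d + 1))}
    {γ' : Fin (d + 1) → ℝ} {t : ℝ} (h : ∀ k, HasDerivAt (fun s => γ s k) (γ' k) t) :
    HasDerivAt (fun s => sqLift g (γ s))
      (∑ k, MvPolynomial.eval (fun i : Fin d => γ t i.castSucc ^ 2) (extPderiv k g) *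
        (2 * γ t k * γ' k)) t := by
  have h1 : HasDerivAt (fun s => fun i : Fin d => γ s i.castSucc ^ 2)
      (fun i => 2 * γ t i.castSucc * γ' i.castSucc) t := by
    rw [hasDerivAt_pi]
    intro i
    simpa using (h i.castSucc).fun_pow 2
  refine ((g.hasFDerivAt_eval _).comp_hasDerivAt t h1).congr_deriv ?_
  simp [Fin.sum_univ_castSucc]

/-- The rotation of a point in the plane spanned by two basis vectors. -/
def planeRotation (i j : Fin (d + 1))
    (v : EuclideanSpace ℝ (Fin (d + 1))) (t : ℝ) : EuclideanSpace ℝ (Fin (d + 1)) :=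
  v + (EuclideanSpace.single i (v i * (Real.cos t - 1) + v j * Real.sin t) +
    EuclideanSpace.single j (v j * (Real.cos t - 1) - v i * Real.sin t))

lemma norm_planeRotation {i j : Fin (d + 1)} (hij : i ≠ j)
    (v : EuclideanSpace ℝ (Fin (d + 1))) (t : ℝ) : ‖planeRotation i j v t‖ = ‖v‖ := by
  rw [← sq_eq_sq₀ (norm_nonneg _) (norm_nonneg _), planeRotation, norm_add_sq_real,
    norm_add_sq_real]
  simp only [inner_add_right, EuclideanSpace.inner_single_right, PiLp.norm_single,
    PiLp.single_apply, if_neg hij.symm, Real.norm_eq_abs, sq_abs, mul_zero, starRingEnd_apply,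
    star_trivial]
  linear_combination (v i ^ 2 + v j ^ 2) * Real.sin_sq_add_cos_sq t

lemma norm_sub_planeRotation_le (i j : Fin (d + 1)) {v : EuclideanSpace ℝ (Fin (d + 1))}
    {M : ℝ} (hi : |v i| ≤ M) (hj : |v j| ≤ M) (t : ℝ) :
    ‖v - planeRotation i j v t‖ ≤ 4 * M * |t| := by
  have hM : 0 ≤ M := (abs_nonneg _).trans hi
  have hc : |Real.cos t - 1| ≤ |t| := by simpa using Real.abs_cos_sub_cos_le t 0
  have hs : |Real.sin t| ≤ |t| := by simpa using Real.abs_sin_sub_sin_le t 0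
  have h : ∀ a b : ℝ, |a| ≤ M → |b| ≤ M →
      |a * (Real.cos t - 1)| + |b * Real.sin t| ≤ 2 * M * |t| := fun a b ha hb => by
    rw [abs_mul, abs_mul]
    have h1 := mul_le_mul ha hc (abs_nonneg _) hM
    have h2 := mul_le_mul hb hs (abs_nonneg _) hM
    linarith
  rw [planeRotation, sub_add_cancel_left, norm_neg]
  refine (norm_add_le _ _).trans ?_
  simp only [PiLp.norm_single, Real.norm_eq_abs]
  have h1 := (abs_add_le (v i * (Real.cos t - 1)) (v j * Real.sin t)).trans (h _ _ hi hj)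
  have h2 := (abs_sub (v j * (Real.cos t - 1)) (v i * Real.sin t)).trans (h _ _ hj hi)
  linarith

lemma hasDerivAt_planeRotation (i j : Fin (d + 1)) (v : EuclideanSpace ℝ (Fin (d + 1)))
    (k : Fin (d + 1)) :
    HasDerivAt (fun s => planeRotation i j v s k)
      ((if k = i then v j else 0) - (if k = j then v i else 0)) 0 := by
  have h1 : ∀ a b : ℝ,
      HasDerivAt (fun s => a * (Real.cos s - 1) + b * Real.sin s) b 0 := fun a b => by
    simpa using (((Real.hasDerivAt_cos 0).sub_const 1).const_mul a).fun_add
      ((Real.hasDerivAt_sin 0).const_mul b)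
  have h2 : (fun s => planeRotation i j v s k) = fun s => v k +
      ((if k = i then v i * (Real.cos s - 1) + v j * Real.sin s else 0) +
        (if k = j then v j * (Real.cos s - 1) + (-v i) * Real.sin s else 0)) := by
    funext s
    simp [planeRotation, sub_eq_add_neg]
  rw [h2, sub_eq_add_neg]
  refine HasDerivAt.const_add _ (HasDerivAt.add ?_ ?_)
  · split_ifs
    · exact h1 _ _
    · exact hasDerivAt_const _ _
  · split_ifs
    · exact h1 _ _
    · simpa using hasDerivAt_const _ _

/-- A pointwise Bernstein inequality for the derivative along an edge. -/
lemma minCoord_mul_abs_le (k : ℕ) : ∃ C : ℝ, 0 < C ∧ ∀ n : ℕ, 0 < n →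
    ∀ g : MvPolynomial (Fin d) ℝ, g.totalDegree ≤ n → ∀ i j : Fin (d + 1), i ≠ j →
    ∀ v ∈ octant (Fin (d + 1)), ∀ A : ℝ, 0 ≤ A →
      (∀ u, ‖u‖ = 1 → |sqLift g u| ≤ A * (1 + n * ‖u - v‖) ^ (2 * k)) →
      minCoord i j v * |sqLift (edgeDeriv i j g) v| ≤ C * n * A := by
  obtain ⟨C, hC1, hC⟩ := IsSph.abs_sub_le_of_localized
    (E := EuclideanSpace ℝ (Fin (d + 1))) k
  refine ⟨2 * C, by linarith, fun n hn g hg i j hij v hv A hA0 hA => ?_⟩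
  have hn0 : (0 : ℝ) < n := by exact_mod_cast hn
  have hC0 : 0 < C := by linarith
  have hvi := hv.2 i
  have hvj := hv.2 j
  set M : ℝ := max (v i) (v j) with hM
  have hiM : |v i| ≤ M := by
    rw [abs_of_nonneg hvi]
    exact le_max_left _ _
  have hjM : |v j| ≤ M := by
    rw [abs_of_nonneg hvj]
    exact le_max_right _ _
  have hm : minCoord i j v = min (v i) (v j) := by
    rw [minCoord, abs_of_nonneg hvi, abs_of_nonneg hvj]
  rcases (show 0 ≤ M from hvi.trans (le_max_left _ _)).eq_or_lt with hM0 | hM0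
  · have h0 : minCoord i j v ≤ 0 := by
      rw [hm, hM0]
      exact min_le_max
    have h1 : 0 ≤ |sqLift (edgeDeriv i j g) v| := abs_nonneg _
    have h2 : 0 ≤ 2 * C * n * A := by positivity
    nlinarith
  have hrot0 : planeRotation i j v 0 = v := by
    ext k
    simp [planeRotation]
  have hder := hasDerivAt_sqLift g (hasDerivAt_planeRotation i j v)
  have hval : (∑ k, MvPolynomial.eval (fun l : Fin d => planeRotation i j v 0 l.castSucc ^ 2)
      (extPderiv k g) * (2 * planeRotation i j v 0 k *
        ((if k = i then v j else 0) - (if k = j then v i else 0)))) =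
      2 * (v i * v j) * sqLift (edgeDeriv i j g) v := by
    simp only [hrot0, mul_sub, Finset.sum_sub_distrib, mul_ite, mul_zero, Finset.sum_ite_eq',
      Finset.mem_univ, if_true, sqLift, edgeDeriv, map_sub]
    ring
  rw [hval] at hder
  have hlip := hder.le_of_lip' (C := C * n * (4 * M) * A) (by positivity) (by
    have hev : ∀ᶠ t : ℝ in nhds 0, n * (4 * M * |t|) < 1 := by
      have hcont : Continuous fun t : ℝ => n * (4 * M * |t|) := by fun_prop
      exact hcont.continuousAt.eventually_lt continuousAt_const (by simp)
    filter_upwards [hev] with t ht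
    have hd := norm_sub_planeRotation_le i j hiM hjM t
    have h1 := hC n hn (sqLift g) (isSph_sqLift hg) v (planeRotation i j v t) hv.1
      (by rw [norm_planeRotation hij, hv.1])
      ((mul_le_mul_of_nonneg_left hd hn0.le).trans ht.le) A hA0 hA
    rw [hrot0, Real.norm_eq_abs, abs_sub_comm, sub_zero, Real.norm_eq_abs]
    calc |sqLift g v - sqLift g (planeRotation i j v t)|
        ≤ C * (n * ‖v - planeRotation i j v t‖) * A := h1
      _ ≤ C * (n * (4 * M * |t|)) * A := by gcongr
      _ = C * n * (4 * M) * A * |t| := by ring)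
  rw [Real.norm_eq_abs, abs_mul, abs_of_nonneg (by positivity), ← min_mul_max (v i) (v j), ← hM,
    ← hm] at hlip
  refine le_of_mul_le_mul_left ?_ hM0
  linarith

lemma isFiniteMeasure_withDensity_minCoord {ι : Type*} [Fintype ι]
    {ν : Measure (EuclideanSpace ℝ ι)} [IsFiniteMeasure ν] (hS : ν (octant ι)ᶜ = 0) {s : ℝ}
    (hs : 0 ≤ s) (i j : ι) :
    IsFiniteMeasure (ν.withDensity fun v => ENNReal.ofReal (minCoord i j v) ^ s) := by
  refine isFiniteMeasure_withDensity (ne_top_of_le_ne_top (measure_ne_top ν Set.univ) ?_)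
  rw [← lintegral_one]
  refine lintegral_mono_ae ?_
  have hS' : ∀ᵐ v ∂ν, v ∈ octant ι := by
    rw [ae_iff]
    exact hS
  filter_upwards [hS'] with v hv
  refine ENNReal.rpow_le_one (ENNReal.ofReal_le_one.mpr ?_) hs
  exact (min_le_left _ _).trans ((PiLp.norm_apply_le v i).trans hv.1.le)

/-- The weighted Bernstein inequality of order one on the sphere. -/
theorem IsDoublingOn.lintegral_edgeDeriv_le {ν : Measure (EuclideanSpace ℝ (Fin (d + 1)))}
    [IsFiniteMeasure ν] {D : NNReal} (hD : IsDoublingOn ν (octant (Fin (d + 1))) D)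
    (hS : ν (octant (Fin (d + 1)))ᶜ = 0) {p : ℝ} (hp : 1 ≤ p) {i j : Fin (d + 1)} (hij : i ≠ j) :
    ∃ c : ENNReal, c ≠ ⊤ ∧ ∀ n : ℕ, 0 < n → ∀ g : MvPolynomial (Fin d) ℝ, g.totalDegree ≤ n →
      ∫⁻ v, ENNReal.ofReal (minCoord i j v) ^ p *
          ENNReal.ofReal |sqLift (edgeDeriv i j g) v| ^ p ∂ν ≤
        c * (n : ENNReal) ^ p * ∫⁻ v, ENNReal.ofReal |sqLift g v| ^ p ∂ν := by
  have hp0 : 0 ≤ p := by linarith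
  obtain ⟨k, c, hc, hmain⟩ := hD.lintegral_rpow_le hS hp
  obtain ⟨C, hC0, hC⟩ := minCoord_mul_abs_le (d := d) k
  refine ⟨ENNReal.ofReal C ^ p * c, ENNReal.mul_ne_top
    (ENNReal.rpow_ne_top_of_nonneg hp0 ENNReal.ofReal_ne_top) hc, fun n hn g hg => ?_⟩
  have hn0 : (0 : ℝ) < n := by exact_mod_cast hn
  set H : EuclideanSpace ℝ (Fin (d + 1)) → ℝ :=
    fun v => minCoord i j v * |sqLift (edgeDeriv i j g) v| / (C * n) with hH
  have h1 := hmain n hn (sqLift g) (isSph_sqLift hg) (continuous_sqLift g) (sqLift_coordAbs g) H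
    (fun v hv A hA0 hA => by
      rw [hH]
      simp only
      rw [div_le_iff₀ (by positivity), mul_comm A]
      exact hC n hn g hg i j hij v hv A hA0 hA)
  have h2 : ∀ v, ENNReal.ofReal (minCoord i j v) ^ p *
      ENNReal.ofReal |sqLift (edgeDeriv i j g) v| ^ p =
      ENNReal.ofReal C ^ p * (n : ENNReal) ^ p * ENNReal.ofReal (H v) ^ p := fun v => by
    have h3 : 0 ≤ minCoord i j v := le_min (abs_nonneg _) (abs_nonneg _)
    rw [← ENNReal.mul_rpow_of_nonneg _ _ hp0, ← ENNReal.mul_rpow_of_nonneg _ _ hp0,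
      ← ENNReal.mul_rpow_of_nonneg _ _ hp0, ← ENNReal.ofReal_natCast, ← ENNReal.ofReal_mul hC0.le,
      ← ENNReal.ofReal_mul h3, ← ENNReal.ofReal_mul (by positivity), hH]
    congr 2
    field_simp
  simp only [h2]
  rw [lintegral_const_mul' _ _ (ENNReal.mul_ne_top
    (ENNReal.rpow_ne_top_of_nonneg hp0 ENNReal.ofReal_ne_top)
    (ENNReal.rpow_ne_top_of_nonneg hp0 (ENNReal.natCast_ne_top n)))]
  calc ENNReal.ofReal C ^ p * (n : ENNReal) ^ p * ∫⁻ v, ENNReal.ofReal (H v) ^ p ∂ν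
      ≤ ENNReal.ofReal C ^ p * (n : ENNReal) ^ p *
        (c * ∫⁻ v, ENNReal.ofReal |sqLift g v| ^ p ∂ν) := mul_le_mul_right h1 _
    _ = _ := by ring

/-- The weighted Bernstein inequality of arbitrary order on the sphere. -/
theorem IsDoublingOn.lintegral_iterate_edgeDeriv_le
    {ν : Measure (EuclideanSpace ℝ (Fin (d + 1)))}
    [IsFiniteMeasure ν] {D : NNReal} (hD : IsDoublingOn ν (octant (Fin (d + 1))) D)
    (hS : ν (octant (Fin (d + 1)))ᶜ = 0) {p : ℝ} (hp : 1 ≤ p) {i j : Fin (d + 1)} (hij : i ≠ j)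
    (r : ℕ) :
    ∃ c : ENNReal, c ≠ ⊤ ∧ ∀ n : ℕ, 0 < n → ∀ g : MvPolynomial (Fin d) ℝ, g.totalDegree ≤ n →
      ∫⁻ v, ENNReal.ofReal (minCoord i j v) ^ (r * p) *
          ENNReal.ofReal |sqLift ((edgeDeriv i j)^[r] g) v| ^ p ∂ν ≤
        c * (n : ENNReal) ^ (r * p) * ∫⁻ v, ENNReal.ofReal |sqLift g v| ^ p ∂ν := by
  have hp0 : 0 ≤ p := by linarith
  induction r with
  | zero => exact ⟨1, by simp, fun n hn g hg => by simp⟩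
  | succ r ih =>
    obtain ⟨c₁, hc₁, h₁⟩ := ih
    have hs : 0 ≤ r * p := by positivity
    have hfin := isFiniteMeasure_withDensity_minCoord hS hs i j
    have hmeas : Measurable fun v : EuclideanSpace ℝ (Fin (d + 1)) =>
        ENNReal.ofReal (minCoord i j v) ^ (r * p) :=
      (continuous_minCoord i j).measurable.ennreal_ofReal.pow_const _
    obtain ⟨D', hD'⟩ := hD.withDensity_minCoord hS hs i j
    obtain ⟨c₂, hc₂, h₂⟩ := hD'.lintegral_edgeDeriv_le
      (withDensity_absolutelyContinuous _ _ hS) hp hij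
    refine ⟨c₂ * c₁, ENNReal.mul_ne_top hc₂ hc₁, fun n hn g hg => ?_⟩
    have hdeg := (totalDegree_iterate_edgeDeriv_le i j g r).trans hg
    have hF : ∀ h : MvPolynomial (Fin d) ℝ, Measurable fun v =>
        ENNReal.ofReal |sqLift h v| ^ p := fun h =>
      (continuous_sqLift h).abs.measurable.ennreal_ofReal.pow_const _
    have h3 := h₂ n hn _ hdeg
    have h4 : ∀ G : EuclideanSpace ℝ (Fin (d + 1)) → ENNReal, Measurable G →
        ∫⁻ v, G v ∂ν.withDensity (fun v => ENNReal.ofReal (minCoord i j v) ^ (r * p)) =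
          ∫⁻ v, ENNReal.ofReal (minCoord i j v) ^ (r * p) * G v ∂ν :=
      fun G hG => lintegral_withDensity_eq_lintegral_mul _ hmeas hG
    have hmF : ∀ h : MvPolynomial (Fin d) ℝ, Measurable fun v : EuclideanSpace ℝ (Fin (d + 1)) =>
        ENNReal.ofReal (minCoord i j v) ^ p * ENNReal.ofReal |sqLift h v| ^ p := fun h =>
      ((continuous_minCoord i j).measurable.ennreal_ofReal.pow_const _).mul (hF h)
    rw [h4 _ (hmF _), h4 _ (hF _)] at h3
    have hexp : ((r + 1 : ℕ) : ℝ) * p = r * p + p := by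
      push_cast
      ring
    rw [hexp, ENNReal.rpow_add_of_nonneg _ _ hs hp0]
    simp only [ENNReal.rpow_add_of_nonneg _ _ hs hp0, Function.iterate_succ_apply', mul_assoc]
    calc _ ≤ _ := h3
      _ ≤ c₂ * (n : ENNReal) ^ p * (c₁ * (n : ENNReal) ^ (r * p) *
          ∫⁻ v, ENNReal.ofReal |sqLift g v| ^ p ∂ν) := mul_le_mul_right (h₁ n hn g hg) _
      _ = _ := by ring

end SphericalBernstein

section Lift

variable {d : ℕ}

/-- The parametrization of the positive part of the sphere by the simplex. -/
def sqrtLift (x : Fin d → ℝ) : EuclideanSpace ℝ (Fin (d + 1)) :=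
  WithLp.toLp 2 (Fin.snoc (α := fun _ => ℝ) (fun i => √(x i)) √(1 - ∑ i, x i))

@[simp] lemma sqrtLift_castSucc (x : Fin d → ℝ) (i : Fin d) :
    sqrtLift x i.castSucc = √(x i) := by
  simp [sqrtLift]

@[simp] lemma sqrtLift_last (x : Fin d → ℝ) :
    sqrtLift x (Fin.last d) = √(1 - ∑ i, x i) := by
  simp [sqrtLift]

lemma continuous_sqrtLift : Continuous (sqrtLift (d := d)) := by
  refine (PiLp.continuous_toLp 2 _).comp (continuous_pi fun k => ?_)
  induction k using Fin.lastCases with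
  | last =>
    simp only [Fin.snoc_last]
    fun_prop
  | cast i =>
    simp only [Fin.snoc_castSucc]
    fun_prop

lemma sqrtLift_mem_octant {x : Fin d → ℝ} (hx : x ∈ Splx d) :
    sqrtLift x ∈ octant (Fin (d + 1)) := by
  refine ⟨?_, fun k => ?_⟩
  · rw [EuclideanSpace.norm_eq, Fin.sum_univ_castSucc, Real.sqrt_eq_one]
    simp only [sqrtLift_castSucc, sqrtLift_last, Real.norm_eq_abs, sq_abs]
    rw [Real.sq_sqrt (by linarith [hx.2])]
    simp only [Real.sq_sqrt (hx.1 _)]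
    ring
  · induction k using Fin.lastCases <;> simp

lemma exists_sqrtLift_eq {v : EuclideanSpace ℝ (Fin (d + 1))} (hv : v ∈ octant (Fin (d + 1))) :
    ∃ x ∈ Splx d, sqrtLift x = v := by
  have h1 := hv.1
  rw [EuclideanSpace.norm_eq, Fin.sum_univ_castSucc, Real.sqrt_eq_one] at h1
  simp only [Real.norm_eq_abs, sq_abs] at h1
  refine ⟨fun i => v i.castSucc ^ 2, ⟨fun i => sq_nonneg _, ?_⟩, ?_⟩
  · nlinarith [sq_nonneg (v (Fin.last d))]
  · ext k
    induction k using Fin.lastCases with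
    | last =>
      rw [sqrtLift_last, ← h1, add_sub_cancel_left, Real.sqrt_sq (hv.2 _)]
    | cast i => rw [sqrtLift_castSucc, Real.sqrt_sq (hv.2 _)]

lemma dT_eq_arccos_inner (x y : Fin d → ℝ) :
    dT x y = Real.arccos (inner ℝ (sqrtLift x) (sqrtLift y)) := by
  rw [dT, PiLp.inner_apply, Fin.sum_univ_castSucc]
  simp [mul_comm]

lemma norm_sub_le_arccos_inner {E : Type*} [NormedAddCommGroup E] [InnerProductSpace ℝ E]
    {u v : E} (hu : ‖u‖ = 1) (hv : ‖v‖ = 1) :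
    ‖u - v‖ ≤ Real.arccos (inner ℝ u v) ∧
      Real.arccos (inner ℝ u v) ≤ Real.pi / 2 * ‖u - v‖ := by
  set c : ℝ := inner ℝ u v with hc
  have hcabs : |c| ≤ 1 := by simpa [hu, hv] using abs_real_inner_le_norm u v
  have hnorm : ‖u - v‖ ^ 2 = 2 - 2 * c := by
    rw [norm_sub_sq_real, hu, hv]
    ring
  have hcos : Real.cos (Real.arccos c) = c :=
    Real.cos_arccos (neg_le_of_abs_le hcabs) (le_of_abs_le hcabs)
  have h0 := Real.arccos_nonneg c
  have hpi := Real.pi_pos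
  constructor
  · refine abs_le_of_sq_le_sq' ?_ h0 |>.2
    have := Real.one_sub_sq_div_two_le_cos (x := Real.arccos c)
    linarith
  · refine abs_le_of_sq_le_sq' ?_ (by positivity) |>.2
    have h1 := Real.cos_le_one_sub_mul_cos_sq (x := Real.arccos c)
      (by rw [abs_of_nonneg h0]; exact Real.arccos_le_pi c)
    rw [hcos] at h1
    rw [mul_pow, hnorm]
    have h2 : 2 / Real.pi ^ 2 * Real.arccos c ^ 2 ≤ 1 - c := by linarith
    rw [div_mul_eq_mul_div, div_le_iff₀ (by positivity)] at h2
    linarith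

lemma norm_sqrtLift_sub_le_dT {x y : Fin d → ℝ} (hx : x ∈ Splx d) (hy : y ∈ Splx d) :
    ‖sqrtLift x - sqrtLift y‖ ≤ dT x y := by
  rw [dT_eq_arccos_inner]
  exact (norm_sub_le_arccos_inner (sqrtLift_mem_octant hx).1 (sqrtLift_mem_octant hy).1).1

lemma dT_le_norm_sqrtLift_sub {x y : Fin d → ℝ} (hx : x ∈ Splx d) (hy : y ∈ Splx d) :
    dT x y ≤ Real.pi / 2 * ‖sqrtLift x - sqrtLift y‖ := by
  rw [dT_eq_arccos_inner]
  exact (norm_sub_le_arccos_inner (sqrtLift_mem_octant hx).1 (sqrtLift_mem_octant hy).1).2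

/-- The measure on the sphere corresponding to a weight on the simplex. -/
def liftMeasure (w : (Fin d → ℝ) → ℝ) : Measure (EuclideanSpace ℝ (Fin (d + 1))) :=
  ((volume.restrict (Splx d)).withDensity fun x => ENNReal.ofReal (w x)).map sqrtLift

lemma lintegral_liftMeasure {w : (Fin d → ℝ) → ℝ} (hw : IntegrableOn w (Splx d))
    {G : EuclideanSpace ℝ (Fin (d + 1)) → ENNReal} (hG : Measurable G) :
    ∫⁻ v, G v ∂liftMeasure w = ∫⁻ x in Splx d, ENNReal.ofReal (w x) * G (sqrtLift x) := by
  rw [liftMeasure, lintegral_map hG continuous_sqrtLift.measurable]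
  exact lintegral_withDensity_eq_lintegral_mul₀ hw.aestronglyMeasurable.aemeasurable.ennreal_ofReal
    (hG.comp continuous_sqrtLift.measurable).aemeasurable

lemma isFiniteMeasure_liftMeasure {w : (Fin d → ℝ) → ℝ} (hw : IntegrableOn w (Splx d)) :
    IsFiniteMeasure (liftMeasure w) := by
  have := isFiniteMeasure_withDensity_ofReal hw.2
  exact Measure.isFiniteMeasure_map _ _

lemma liftMeasure_compl_octant (w : (Fin d → ℝ) → ℝ) :
    liftMeasure w (octant (Fin (d + 1)))ᶜ = 0 := by
  rw [liftMeasure, Measure.map_apply continuous_sqrtLift.measurable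
    isClosed_octant.measurableSet.compl]
  refine withDensity_absolutelyContinuous _ _ ?_
  refine measure_mono_null (fun x hx hx' => hx (sqrtLift_mem_octant hx')) ?_
    (t := (Splx d)ᶜ)
  rw [Measure.restrict_apply isClosed_Splx.measurableSet.compl, Set.compl_inter_self, measure_empty]

lemma liftMeasure_closedBall (w : (Fin d → ℝ) → ℝ) (v : EuclideanSpace ℝ (Fin (d + 1))) (R : ℝ) :
    liftMeasure w (Metric.closedBall v R) =
      ∫⁻ x in sqrtLift ⁻¹' Metric.closedBall v R ∩ Splx d, ENNReal.ofReal (w x) := by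
  have hm := continuous_sqrtLift (d := d).measurable Metric.isClosed_closedBall.measurableSet
    (t := Metric.closedBall v R)
  rw [liftMeasure, Measure.map_apply continuous_sqrtLift.measurable
    Metric.isClosed_closedBall.measurableSet, withDensity_apply _ hm, Measure.restrict_restrict hm]

theorem IsDoubling.isDoublingOn_liftMeasure {w : (Fin d → ℝ) → ℝ} (hw : IsDoubling w) :
    ∃ D : NNReal, IsDoublingOn (liftMeasure w) (octant (Fin (d + 1))) D := by
  obtain ⟨hw0, hwi, cw, hcw, hdbl⟩ := hw
  have hball : ∀ x ρ, ENNReal.ofReal (∫ y in ballT x ρ, w y) =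
      ∫⁻ y in ballT x ρ, ENNReal.ofReal (w y) := fun x ρ =>
    ofReal_integral_eq_lintegral_ofReal (hwi.mono_set fun y hy => hy.1)
      (Filter.Eventually.of_forall hw0)
  refine ⟨(cw * cw).toNNReal, fun v hv R hR => ?_⟩
  obtain ⟨x, hx, rfl⟩ := exists_sqrtLift_eq hv
  have hpi := Real.pi_pos
  rw [liftMeasure_closedBall, liftMeasure_closedBall]
  calc ∫⁻ y in sqrtLift ⁻¹' Metric.closedBall (sqrtLift x) (2 * R) ∩ Splx d, ENNReal.ofReal (w y)
      ≤ ∫⁻ y in ballT x (2 * (2 * (Real.pi * R / 4))), ENNReal.ofReal (w y) := by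
        refine lintegral_mono_set fun y hy => ⟨hy.2, ?_⟩
        have h1 : ‖sqrtLift x - sqrtLift y‖ ≤ 2 * R := by
          rw [← dist_eq_norm, dist_comm]
          exact hy.1
        refine (dT_le_norm_sqrtLift_sub hx hy.2).trans ?_
        have := mul_le_mul_of_nonneg_left h1 hpi.le
        linarith
    _ = ENNReal.ofReal (∫ y in ballT x (2 * (2 * (Real.pi * R / 4))), w y) := (hball _ _).symm
    _ ≤ ENNReal.ofReal (cw * cw * ∫ y in ballT x (Real.pi * R / 4), w y) := by
        refine ENNReal.ofReal_le_ofReal ((hdbl x hx _ (by positivity)).trans ?_)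
        rw [mul_assoc]
        exact mul_le_mul_of_nonneg_left (hdbl x hx _ (by positivity)) hcw.le
    _ = ENNReal.ofReal (cw * cw) * ∫⁻ y in ballT x (Real.pi * R / 4), ENNReal.ofReal (w y) := by
        rw [ENNReal.ofReal_mul (by positivity), hball]
    _ ≤ _ := by
        refine mul_le_mul_right (lintegral_mono_set ?_) _
        intro y hy
        refine ⟨?_, hy.1⟩
        rw [Set.mem_preimage, Metric.mem_closedBall, dist_comm, dist_eq_norm]
        refine (norm_sqrtLift_sub_le_dT hx hy.1).trans (hy.2.trans ?_)
        nlinarith [Real.pi_lt_four]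

lemma sqLift_sqrtLift (g : MvPolynomial (Fin d) ℝ) {x : Fin d → ℝ} (hx : x ∈ Splx d) :
    sqLift g (sqrtLift x) = MvPolynomial.eval x g := by
  simp [sqLift, Real.sq_sqrt (hx.1 _)]

end Lift

section Simplex

variable {d : ℕ}

/-- The Bernstein inequality for the iterated derivative along an edge of the simplex. -/
theorem IsDoubling.integral_iterate_edgeDeriv_le {w : (Fin d → ℝ) → ℝ} (hw : IsDoubling w) {p : ℝ}
    (hp : 1 ≤ p) (r : ℕ) {i j : Fin (d + 1)} (hij : i ≠ j) :
    ∃ c : ℝ, 0 ≤ c ∧ ∀ n : ℕ, 0 < n → ∀ f : MvPolynomial (Fin d) ℝ, f.totalDegree ≤ n →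
      ∀ φ : (Fin d → ℝ) → ℝ, (∀ x ∈ Splx d, |φ x| ≤ minCoord i j (sqrtLift x)) →
        (∫ x in Splx d, |φ x ^ r * MvPolynomial.eval x ((edgeDeriv i j)^[r] f)| ^ p * w x) ^ (1 / p)
          ≤ c * (n : ℝ) ^ r *
            (∫ x in Splx d, |MvPolynomial.eval x f| ^ p * w x) ^ (1 / p) := by
  have hp0 : 0 < p := by linarith
  obtain ⟨D, hD⟩ := hw.isDoublingOn_liftMeasure
  obtain ⟨hw0, hwi, -⟩ := hw
  have := isFiniteMeasure_liftMeasure hwi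
  obtain ⟨c, hc, hmain⟩ := hD.lintegral_iterate_edgeDeriv_le (liftMeasure_compl_octant w) hp hij r
  refine ⟨c.toReal ^ (1 / p), by positivity, fun n hn f hf φ hφ => ?_⟩
  have hF : ∀ h : MvPolynomial (Fin d) ℝ, Measurable fun v =>
      ENNReal.ofReal |sqLift h v| ^ p := fun h =>
    (continuous_sqLift h).abs.measurable.ennreal_ofReal.pow_const _
  set A := ∫ x in Splx d, |φ x ^ r * MvPolynomial.eval x ((edgeDeriv i j)^[r] f)| ^ p * w x with hA
  set B := ∫ x in Splx d, |MvPolynomial.eval x f| ^ p * w x with hB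
  have hnonneg : ∀ (a : ℝ) x, 0 ≤ |a| ^ p * w x := fun a x =>
    mul_nonneg (by positivity) (hw0 x)
  have hA0 : 0 ≤ A := integral_nonneg fun x => hnonneg (φ x ^ r * _) x
  have hB0 : 0 ≤ B := integral_nonneg fun x => hnonneg (MvPolynomial.eval x f) x
  have hBint : IntegrableOn (fun x => |MvPolynomial.eval x f| ^ p * w x) (Splx d) := by
    have hcont : Continuous fun x => |MvPolynomial.eval x f| ^ p :=
      (MvPolynomial.continuous_eval f).abs.rpow_const fun _ => Or.inr hp0.le
    exact hwi.continuousOn_mul hcont.continuousOn isCompact_Splx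
  have hAle : ENNReal.ofReal A ≤ ∫⁻ v, ENNReal.ofReal (minCoord i j v) ^ (r * p) *
      ENNReal.ofReal |sqLift ((edgeDeriv i j)^[r] f) v| ^ p ∂liftMeasure w := by
    have hmeas : Measurable fun v => ENNReal.ofReal (minCoord i j v) ^ (r * p) *
        ENNReal.ofReal |sqLift ((edgeDeriv i j)^[r] f) v| ^ p :=
      ((continuous_minCoord i j).measurable.ennreal_ofReal.pow_const _).mul (hF _)
    rw [lintegral_liftMeasure hwi hmeas, ← Real.enorm_of_nonneg hA0, hA]
    refine (enorm_integral_le_lintegral_enorm _).trans ?_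
    refine setLIntegral_mono' isClosed_Splx.measurableSet fun x hx => ?_
    rw [Real.enorm_of_nonneg (hnonneg _ x), ENNReal.ofReal_mul (by positivity), mul_comm,
      sqLift_sqrtLift _ hx, ENNReal.rpow_mul, ENNReal.rpow_natCast,
      ← ENNReal.mul_rpow_of_nonneg _ _ hp0.le, ← ENNReal.ofReal_rpow_of_nonneg (abs_nonneg _) hp0.le,
      abs_mul, abs_pow, ENNReal.ofReal_mul (by positivity), ENNReal.ofReal_pow (abs_nonneg _)]
    have := hφ x hx
    gcongr
  have hBeq : ∫⁻ v, ENNReal.ofReal |sqLift f v| ^ p ∂liftMeasure w = ENNReal.ofReal B := by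
    rw [lintegral_liftMeasure hwi (hF f), hB, ofReal_integral_eq_lintegral_ofReal hBint
      (Filter.Eventually.of_forall fun x => hnonneg (MvPolynomial.eval x f) x)]
    refine setLIntegral_congr_fun isClosed_Splx.measurableSet fun x hx => ?_
    rw [sqLift_sqrtLift _ hx, ENNReal.ofReal_mul (by positivity), mul_comm,
      ENNReal.ofReal_rpow_of_nonneg (abs_nonneg _) hp0.le]
  have hAB : A ≤ c.toReal * ((n : ℝ) ^ r) ^ p * B := by
    have h1 := hAle.trans (hmain n hn f hf)
    rw [hBeq, ← ENNReal.ofReal_toReal hc, ENNReal.rpow_mul, ENNReal.rpow_natCast,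
      ← ENNReal.ofReal_natCast, ← ENNReal.ofReal_pow (by positivity),
      ENNReal.ofReal_rpow_of_nonneg (by positivity) hp0.le, ← ENNReal.ofReal_mul (by positivity),
      ← ENNReal.ofReal_mul (by positivity)] at h1
    exact (ENNReal.ofReal_le_ofReal_iff (by positivity)).mp h1
  calc A ^ (1 / p) ≤ (c.toReal * ((n : ℝ) ^ r) ^ p * B) ^ (1 / p) :=
        Real.rpow_le_rpow hA0 hAB (by positivity)
    _ = c.toReal ^ (1 / p) * (n : ℝ) ^ r * B ^ (1 / p) := by
        rw [Real.mul_rpow (by positivity) hB0, Real.mul_rpow (by positivity) (by positivity),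
          ← Real.rpow_mul (by positivity), mul_one_div_cancel hp0.ne', Real.rpow_one]

lemma iterate_pd_eval (i : Fin d) (r : ℕ) (f : MvPolynomial (Fin d) ℝ) :
    (pd i)^[r] (fun y => MvPolynomial.eval y f) =
      fun x => MvPolynomial.eval x ((edgeDeriv i.castSucc (Fin.last d))^[r] f) := by
  induction r with
  | zero => rfl
  | succ r ih =>
    rw [Function.iterate_succ_apply', ih, pd_eval, Function.iterate_succ_apply']
    simp [edgeDeriv]

lemma iterate_pdd_eval (i j : Fin d) (r : ℕ) (f : MvPolynomial (Fin d) ℝ) :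
    (pdd i j)^[r] (fun y => MvPolynomial.eval y f) =
      fun x => MvPolynomial.eval x ((edgeDeriv i.castSucc j.castSucc)^[r] f) := by
  induction r with
  | zero => rfl
  | succ r ih =>
    rw [Function.iterate_succ_apply', ih, Function.iterate_succ_apply']
    funext x
    rw [pdd, pd_eval, pd_eval]
    simp [edgeDeriv]

lemma abs_sqrt_mul_sqrt_div_le {a b : ℝ} (ha : 0 ≤ a) (hb : 0 ≤ b) :
    |√a * √b / √(a + b)| ≤ min |√a| |√b| := by
  have h1 : √a ≤ √(a + b) := Real.sqrt_le_sqrt (by linarith)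
  have h2 : √b ≤ √(a + b) := Real.sqrt_le_sqrt (by linarith)
  rw [abs_of_nonneg (by positivity), abs_of_nonneg (Real.sqrt_nonneg a),
    abs_of_nonneg (Real.sqrt_nonneg b)]
  refine le_min (div_le_of_le_mul₀ (by positivity) (by positivity) ?_)
    (div_le_of_le_mul₀ (by positivity) (by positivity) ?_)
  · exact mul_le_mul_of_nonneg_left h2 (Real.sqrt_nonneg a)
  · rw [mul_comm]
    exact mul_le_mul_of_nonneg_left h1 (Real.sqrt_nonneg b)

end Simplex

/-- `L^p` Bernstein inequalities for a doubling weight on the simplex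
(Theorem 3.1), with `φ_i(x) = √(x_i)√(1-|x|)/√(x_i+1-|x|)` and
`φ_{i,j}(x) = √(x_i)√(x_j)/√(x_i+x_j)`. -/
theorem stmt16 (d : ℕ) (hd : 2 ≤ d) (w : (Fin d → ℝ) → ℝ) (hw : IsDoubling w)
    (r : ℕ) (p : ℝ) (hp : 1 ≤ p) :
    ∃ c > 0, ∀ n : ℕ, 0 < n → ∀ f : MvPolynomial (Fin d) ℝ, f.totalDegree ≤ n →
      (∀ i : Fin d,
        (∫ x in Splx d,
            |(Real.sqrt (x i) * Real.sqrt (1 - ∑ k, x k) /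
                Real.sqrt (x i + 1 - ∑ k, x k)) ^ r *
              (pd i)^[r] (fun y => MvPolynomial.eval y f) x| ^ p * w x) ^ (1/p)
          ≤ c * (n : ℝ) ^ r *
            (∫ x in Splx d, |MvPolynomial.eval x f| ^ p * w x) ^ (1/p)) ∧
      (∀ i j : Fin d, i < j →
        (∫ x in Splx d,
            |(Real.sqrt (x i) * Real.sqrt (x j) / Real.sqrt (x i + x j)) ^ r *
              (pdd i j)^[r] (fun y => MvPolynomial.eval y f) x| ^ p * w x) ^ (1/p)
          ≤ c * (n : ℝ) ^ r *
            (∫ x in Splx d, |MvPolynomial.eval x f| ^ p * w x) ^ (1/p)) := by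
  have hedge : ∀ i j : Fin (d + 1), ∃ c : ℝ, 0 ≤ c ∧ (i ≠ j → ∀ n : ℕ, 0 < n →
      ∀ f : MvPolynomial (Fin d) ℝ, f.totalDegree ≤ n →
      ∀ φ : (Fin d → ℝ) → ℝ, (∀ x ∈ Splx d, |φ x| ≤ minCoord i j (sqrtLift x)) →
        (∫ x in Splx d, |φ x ^ r * MvPolynomial.eval x ((edgeDeriv i j)^[r] f)| ^ p * w x) ^ (1 / p)
          ≤ c * (n : ℝ) ^ r *
            (∫ x in Splx d, |MvPolynomial.eval x f| ^ p * w x) ^ (1 / p)) := fun i j => by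
    by_cases hij : i = j
    · exact ⟨0, le_rfl, fun h => absurd hij h⟩
    · obtain ⟨c, hc0, hc⟩ := hw.integral_iterate_edgeDeriv_le hp r hij
      exact ⟨c, hc0, fun _ => hc⟩
  choose c hc0 hc using hedge
  have hle : ∀ i j, c i j ≤ 1 + ∑ i, ∑ j, c i j := fun i j => by
    have h1 := Finset.single_le_sum (fun j _ => hc0 i j) (Finset.mem_univ j)
    have h2 := Finset.single_le_sum (f := fun i => ∑ j, c i j)
      (fun i _ => Finset.sum_nonneg fun j _ => hc0 i j) (Finset.mem_univ i)
    linarith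
  have hpos : 0 ≤ ∑ i, ∑ j, c i j :=
    Finset.sum_nonneg fun i _ => Finset.sum_nonneg fun j _ => hc0 i j
  refine ⟨1 + ∑ i, ∑ j, c i j, by linarith, fun n hn f hf => ?_⟩
  have hB : 0 ≤ ∫ x in Splx d, |MvPolynomial.eval x f| ^ p * w x :=
    integral_nonneg fun x => mul_nonneg (by positivity) (hw.1 x)
  refine ⟨fun i => ?_, fun i j hij => ?_⟩
  · rw [iterate_pd_eval]
    refine (hc i.castSucc (Fin.last d) (Fin.castSucc_lt_last i).ne n hn f hf _
      fun x hx => ?_).trans ?_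
    · rw [minCoord, sqrtLift_castSucc, sqrtLift_last, add_sub_assoc]
      exact abs_sqrt_mul_sqrt_div_le (hx.1 i) (by linarith [hx.2])
    · have := hle i.castSucc (Fin.last d)
      gcongr
  · rw [iterate_pdd_eval]
    refine (hc i.castSucc j.castSucc (by simpa using hij.ne) n hn f hf _
      fun x hx => ?_).trans ?_
    · rw [minCoord, sqrtLift_castSucc, sqrtLift_castSucc]
      exact abs_sqrt_mul_sqrt_div_le (hx.1 i) (hx.1 j)
    · have := hle i.castSucc j.castSucc
      gcongr
end
end
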